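/- Let β > 0 with β² ≠ 1/4, set γ = √(1/4 − β²) (principal square root) and μ = Re γ. For each integer m ≥ 1 let ρ⁰_m, ω⁰_m : ℝ → ℂ be smooth and compactly supported, set W(ζ) = W_{0,γ}(2mζ), G_m(η,ξ,y) = (∂_y² − m²)(ρ⁰_m(ξ+y−η) − β^{−2} ξ ω⁰_m(ξ+y−η)), ψ_m(t,y) = (e^{−imyt} cos(γπ)/(2mπ)) [∫₀^∞ e^{imηt} W(η) ∫₀^∞ W(ξ) G_m(η,ξ,y) dξ dη − ∫₀^∞ e^{−imηt} W(η) ∫₀^∞ W(ξ) G_m(−η,−ξ,y) dξ dη], and Q_{1,m} = ∑_{k=0}^{3} (‖∂_y^k ρ⁰_m‖_{L²(ℝ)} + ‖∂_y^k ω⁰_m‖_{L²(ℝ)}). Then there exists a constant C > 0 depending only on β such that for all t ≥ 1, ( ∑_{m=1}^∞ ‖∂_y ψ_m(t,·)‖²_{L²(ℝ)} )^{1/2} ≤ C t^{−1/2+μ} ( ∑_{m=1}^∞ Q_{1,m}² )^{1/2}. -/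

import Mathlib

open MeasureTheory Complex Set
open scoped ENNReal Real

noncomputable section

/-- Pochhammer symbol `(a)_s = a (a+1) ⋯ (a+s−1)`. -/
def poch (a : ℂ) (s : ℕ) : ℂ := ∏ i ∈ Finset.range s, (a + (i : ℂ))

/-- Confluent hypergeometric function `M(a,b,ζ) = ∑_s (a)_s/((b)_s s!) ζ^s`. -/
def chgM (a b ζ : ℂ) : ℂ := ∑' s : ℕ, poch a s / (poch b s * (Nat.factorial s : ℂ)) * ζ ^ s

/-- Whittaker function `M_{0,γ}(ζ) = e^{−ζ/2} ζ^{1/2+γ} M(1/2+γ, 1+2γ, ζ)`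
(principal branch of the complex power). -/
def whittM (γ ζ : ℂ) : ℂ :=
  Complex.exp (-ζ / 2) * ζ ^ ((1 : ℂ) / 2 + γ) * chgM ((1 : ℂ) / 2 + γ) (1 + 2 * γ) ζ

/-- Whittaker function
`W_{0,γ}(ζ) = (Γ(−2γ)/Γ(1/2−γ)) M_{0,γ}(ζ) + (Γ(2γ)/Γ(1/2+γ)) M_{0,−γ}(ζ)`. -/
def whittW (γ ζ : ℂ) : ℂ :=
  Complex.Gamma (-(2 * γ)) / Complex.Gamma ((1 : ℂ) / 2 - γ) * whittM γ ζ
    + Complex.Gamma (2 * γ) / Complex.Gamma ((1 : ℂ) / 2 + γ) * whittM (-γ) ζ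

/-- `γ = √(1/4 − β²)`, principal square root. -/
def gam (β : ℝ) : ℂ := ((1 / 4 - β ^ 2 : ℝ) : ℂ) ^ ((1 : ℂ) / 2)

/-- `G_m(η,ξ,y) = (∂_y² − m²)(ρ⁰(ξ+y−η) − β^{−2} ξ ω⁰(ξ+y−η))`. -/
def Gm (β : ℝ) (m : ℕ) (ρ₀ ω₀ : ℝ → ℂ) (η ξ y : ℝ) : ℂ :=
  (deriv (deriv ρ₀) (ξ + y - η) - (m : ℂ) ^ 2 * ρ₀ (ξ + y - η))
    - (1 / (β : ℂ) ^ 2) * (ξ : ℂ) *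
        (deriv (deriv ω₀) (ξ + y - η) - (m : ℂ) ^ 2 * ω₀ (ξ + y - η))

/-- The explicit stream-function mode `ψ_m(t,y)` of Theorem 1.1, with
`W(ζ) = W_{0,γ}(2mζ)`. -/
def psiM (β : ℝ) (m : ℕ) (ρ₀ ω₀ : ℝ → ℂ) (t y : ℝ) : ℂ :=
  Complex.exp (-(Complex.I * m * y * t)) * Complex.cos (gam β * (π : ℂ)) / (2 * m * (π : ℂ)) *
    ((∫ η in Set.Ioi (0 : ℝ), Complex.exp (Complex.I * m * η * t) *
        whittW (gam β) (2 * (m : ℂ) * (η : ℂ)) *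
        ∫ ξ in Set.Ioi (0 : ℝ), whittW (gam β) (2 * (m : ℂ) * (ξ : ℂ)) * Gm β m ρ₀ ω₀ η ξ y)
      - ∫ η in Set.Ioi (0 : ℝ), Complex.exp (-(Complex.I * m * η * t)) *
          whittW (gam β) (2 * (m : ℂ) * (η : ℂ)) *
          ∫ ξ in Set.Ioi (0 : ℝ), whittW (gam β) (2 * (m : ℂ) * (ξ : ℂ)) * Gm β m ρ₀ ω₀ (-η) (-ξ) y)

/-- `Q_{j,m}`-type quantity: sum of the `L²` norms of the first `n−1` derivatives of the data. -/
def Qsum (n : ℕ) (ρ₀ ω₀ : ℝ → ℂ) : ℝ≥0∞ :=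
  ∑ k ∈ Finset.range n,
    (eLpNorm (iteratedDeriv k ρ₀) 2 (volume : Measure ℝ)
      + eLpNorm (iteratedDeriv k ω₀) 2 (volume : Measure ℝ))

section

open Filter Topology

/-- The weight `(s(1-s))^{a-1}` of the Poisson-type integrals. -/
def poissonWeight (a : ℂ) (s : ℝ) : ℂ := (s : ℂ) ^ (a - 1) * (1 - (s : ℂ)) ^ (a - 1)

/-- The moments `∫₀¹ (2s-1)^k e^{x(2s-1)} (s(1-s))^{a-1} ds`. -/
def poissonInt (a : ℂ) (k : ℕ) (x : ℝ) : ℂ :=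
  ∫ s in (0 : ℝ)..1, ((2 * s - 1 : ℝ) : ℂ) ^ k * ((Real.exp (x * (2 * s - 1)) : ℝ) : ℂ)
    * poissonWeight a s

lemma intervalIntegrable_poissonWeight {a : ℂ} (ha : 0 < a.re) :
    IntervalIntegrable (poissonWeight a) volume 0 1 :=
  Complex.betaIntegral_convergent ha ha

lemma intervalIntegrable_poissonInt {a : ℂ} (ha : 0 < a.re) (k : ℕ) (x : ℝ) :
    IntervalIntegrable (fun s : ℝ => ((2 * s - 1 : ℝ) : ℂ) ^ k *
      ((Real.exp (x * (2 * s - 1)) : ℝ) : ℂ) * poissonWeight a s) volume 0 1 := by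
  refine (intervalIntegrable_poissonWeight ha).continuousOn_mul ?_
  apply Continuous.continuousOn
  fun_prop

lemma norm_poissonInt_le {a : ℂ} (ha : 0 < a.re) (k : ℕ) {x : ℝ} (hx : 0 ≤ x) :
    ‖poissonInt a k x‖ ≤ Real.exp x * ∫ s in (0 : ℝ)..1, ‖poissonWeight a s‖ := by
  unfold poissonInt
  rw [← intervalIntegral.integral_const_mul]
  refine intervalIntegral.norm_integral_le_of_norm_le zero_le_one ?_ ?_
  · refine Eventually.of_forall fun s hs => ?_
    have h1 : |2 * s - 1| ≤ 1 := by rw [abs_le]; constructor <;> linarith [hs.1, hs.2]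
    rw [norm_mul, norm_mul, norm_pow, Complex.norm_real, Complex.norm_real, Real.norm_eq_abs,
      Real.norm_eq_abs, Real.abs_exp]
    refine mul_le_mul_of_nonneg_right ?_ (norm_nonneg _)
    calc |2 * s - 1| ^ k * Real.exp (x * (2 * s - 1)) ≤ 1 * Real.exp x := by
          gcongr
          · exact pow_le_one₀ (abs_nonneg _) h1
          · nlinarith [hs.2]
      _ = Real.exp x := one_mul _
  · exact (intervalIntegrable_poissonWeight ha).norm.const_mul _

lemma hasDerivAt_poissonInt {a : ℂ} (ha : 0 < a.re) (k : ℕ) (x : ℝ) :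
    HasDerivAt (poissonInt a k) (poissonInt a (k + 1) x) x := by
  have key := (intervalIntegral.hasDerivAt_integral_of_dominated_loc_of_deriv_le
    (𝕜 := ℝ) (μ := volume) (a := 0) (b := 1) (x₀ := x) (s := Metric.ball x 1)
    (F := fun x s => ((2 * s - 1 : ℝ) : ℂ) ^ k * ((Real.exp (x * (2 * s - 1)) : ℝ) : ℂ)
      * poissonWeight a s)
    (F' := fun x s => ((2 * s - 1 : ℝ) : ℂ) ^ (k + 1) * ((Real.exp (x * (2 * s - 1)) : ℝ) : ℂ)
      * poissonWeight a s)
    (bound := fun s => Real.exp (|x| + 1) * ‖poissonWeight a s‖)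
    (Metric.ball_mem_nhds x one_pos) ?_ (intervalIntegrable_poissonInt ha k x) ?_ ?_ ?_ ?_).2
  · exact key
  · exact Eventually.of_forall fun y =>
      (intervalIntegrable_poissonInt ha k y).def'.aestronglyMeasurable
  · exact (intervalIntegrable_poissonInt ha (k + 1) x).def'.aestronglyMeasurable
  · refine Eventually.of_forall fun s hs y hy => ?_
    rw [uIoc_of_le zero_le_one] at hs
    have h1 : |2 * s - 1| ≤ 1 := by rw [abs_le]; constructor <;> linarith [hs.1, hs.2]
    have hy' : |y| ≤ |x| + 1 := by
      rw [Metric.mem_ball, Real.dist_eq] at hy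
      have := abs_sub_abs_le_abs_sub y x
      linarith
    rw [norm_mul, norm_mul, norm_pow, Complex.norm_real, Complex.norm_real, Real.norm_eq_abs,
      Real.norm_eq_abs, Real.abs_exp]
    refine mul_le_mul_of_nonneg_right ?_ (norm_nonneg _)
    calc |2 * s - 1| ^ (k + 1) * Real.exp (y * (2 * s - 1)) ≤ 1 * Real.exp (|x| + 1) := by
          gcongr
          · exact pow_le_one₀ (abs_nonneg _) h1
          · calc y * (2 * s - 1) ≤ |y * (2 * s - 1)| := le_abs_self _
              _ = |y| * |2 * s - 1| := abs_mul _ _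
              _ ≤ |y| * 1 := by gcongr
              _ ≤ |x| + 1 := by linarith
      _ = _ := one_mul _
  · exact (intervalIntegrable_poissonWeight ha).norm.const_mul _
  · refine Eventually.of_forall fun s _ y _ => ?_
    have h1 : HasDerivAt (fun y : ℝ => Real.exp (y * (2 * s - 1)))
        (Real.exp (y * (2 * s - 1)) * (1 * (2 * s - 1))) y :=
      ((hasDerivAt_id y).mul_const _).exp
    have h2 := ((h1.ofReal_comp).const_mul (((2 * s - 1 : ℝ) : ℂ) ^ k)).mul_const
      (poissonWeight a s)
    refine h2.congr_deriv ?_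
    push_cast
    ring

lemma poissonInt_recurrence {a : ℂ} (ha : 0 < a.re) (x : ℝ) :
    (x : ℂ) * (poissonInt a 0 x - poissonInt a 2 x) = 2 * a * poissonInt a 1 x := by
  have ha0 : a ≠ 0 := by rintro rfl; simp at ha
  set F : ℝ → ℂ := fun s => ((Real.exp (x * (2 * s - 1)) : ℝ) : ℂ) *
    ((s : ℂ) ^ a * (1 - (s : ℂ)) ^ a)
  have hd : ∀ s ∈ Ioo (0 : ℝ) 1, HasDerivAt F
      (((x : ℂ) / 2) * (((2 * s - 1 : ℝ) : ℂ) ^ 0 * ((Real.exp (x * (2 * s - 1)) : ℝ) : ℂ)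
        * poissonWeight a s) - ((x : ℂ) / 2) * (((2 * s - 1 : ℝ) : ℂ) ^ 2 *
        ((Real.exp (x * (2 * s - 1)) : ℝ) : ℂ) * poissonWeight a s)
        - a * (((2 * s - 1 : ℝ) : ℂ) ^ 1 * ((Real.exp (x * (2 * s - 1)) : ℝ) : ℂ)
        * poissonWeight a s)) s := by
    intro s hs
    have hs0 : (s : ℂ) ≠ 0 := by exact_mod_cast hs.1.ne'
    have hs1 : (1 - (s : ℂ)) ≠ 0 := by
      rw [sub_ne_zero]; exact_mod_cast hs.2.ne'
    have e1 : HasDerivAt (fun s : ℝ => Real.exp (x * (2 * s - 1)))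
        (Real.exp (x * (2 * s - 1)) * (x * (2 * 1))) s :=
      ((((hasDerivAt_id s).const_mul 2).sub_const 1).const_mul x).exp
    have e2 : HasDerivAt (fun s : ℂ => s ^ a) (a * (s : ℂ) ^ (a - 1)) (s : ℂ) := by
      have := (hasDerivAt_id (s : ℂ)).cpow_const (c := a) (Or.inl (by simpa using hs.1))
      simpa using this
    have e3 : HasDerivAt (fun s : ℂ => (1 - s) ^ a) (a * (1 - (s : ℂ)) ^ (a - 1) * (-1))
        (s : ℂ) := by
      have := ((hasDerivAt_id (s : ℂ)).const_sub 1).cpow_const (c := a)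
        (Or.inl (by simpa using hs.2))
      simpa using this
    have e4 := e1.ofReal_comp.mul (e2.comp_ofReal.mul e3.comp_ofReal)
    refine e4.congr_deriv ?_
    have p1 : (s : ℂ) ^ a = (s : ℂ) ^ (a - 1) * s := by
      rw [Complex.cpow_sub _ _ hs0, Complex.cpow_one, div_mul_cancel₀ _ hs0]
    have p2 : (1 - (s : ℂ)) ^ a = (1 - (s : ℂ)) ^ (a - 1) * (1 - s) := by
      rw [Complex.cpow_sub _ _ hs1, Complex.cpow_one, div_mul_cancel₀ _ hs1]
    simp only [Pi.mul_apply]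
    rw [p1, p2]
    unfold poissonWeight
    push_cast
    ring
  have hi : ∀ k, IntervalIntegrable (fun s : ℝ => ((2 * s - 1 : ℝ) : ℂ) ^ k *
      ((Real.exp (x * (2 * s - 1)) : ℝ) : ℂ) * poissonWeight a s) volume 0 1 :=
    fun k => intervalIntegrable_poissonInt ha k x
  have hc : ContinuousOn F (Icc 0 1) := by
    refine Continuous.continuousOn ?_
    have c1 : Continuous fun s : ℝ => (s : ℂ) ^ a := by
      refine Complex.continuous_ofReal_cpow_const ha
    have c2 : Continuous fun s : ℝ => (1 - (s : ℂ)) ^ a := by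
      have := c1.comp (continuous_const.sub continuous_id : Continuous fun s : ℝ => (1 : ℝ) - s)
      simpa [Function.comp_def] using this
    exact (by fun_prop : Continuous fun s : ℝ => ((Real.exp (x * (2 * s - 1)) : ℝ) : ℂ)).mul
      (c1.mul c2)
  have key := intervalIntegral.integral_eq_sub_of_hasDerivAt_of_le zero_le_one hc hd
    ((((hi 0).const_mul _).sub ((hi 2).const_mul _)).sub ((hi 1).const_mul _))
  rw [intervalIntegral.integral_sub (((hi 0).const_mul _).sub ((hi 2).const_mul _))
    ((hi 1).const_mul _), intervalIntegral.integral_sub ((hi 0).const_mul _)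
    ((hi 2).const_mul _), intervalIntegral.integral_const_mul,
    intervalIntegral.integral_const_mul, intervalIntegral.integral_const_mul] at key
  have hF : F 1 - F 0 = 0 := by simp [F, ha0]
  rw [hF] at key
  change (x : ℂ) / 2 * poissonInt a 0 x - (x : ℂ) / 2 * poissonInt a 2 x
    - a * poissonInt a 1 x = 0 at key
  linear_combination 2 * key

lemma Gamma_add_nat_eq_poch_mul {a : ℂ} (ha : 0 < a.re) (n : ℕ) :
    Complex.Gamma (a + n) = poch a n * Complex.Gamma a := by
  induction n with
  | zero => simp [poch]
  | succ n ih =>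
    have h0 : a + n ≠ 0 := by
      intro h
      have := congrArg Complex.re h
      simp at this
      have hn : (0 : ℝ) ≤ n := n.cast_nonneg
      linarith
    rw [Nat.cast_succ, ← add_assoc, Complex.Gamma_add_one _ h0, ih]
    simp only [poch, Finset.prod_range_succ]
    ring

lemma poch_ne_zero {a : ℂ} (ha : 0 < a.re) (n : ℕ) : poch a n ≠ 0 := by
  intro h
  have := Gamma_add_nat_eq_poch_mul ha n
  rw [h, zero_mul] at this
  refine Complex.Gamma_ne_zero_of_re_pos (s := a + n) ?_ this
  simp
  positivity

lemma betaIntegral_add_nat {a : ℂ} (ha : 0 < a.re) (n : ℕ) :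
    Complex.betaIntegral (a + n) a
      = poch a n / poch (2 * a) n * Complex.betaIntegral a a := by
  have h2 : 0 < (2 * a).re := by simpa using ha
  have hn : 0 < (a + n).re := by simp; positivity
  rw [Complex.betaIntegral_eq_Gamma_mul_div _ _ hn ha,
    Complex.betaIntegral_eq_Gamma_mul_div _ _ ha ha,
    show a + n + a = 2 * a + n by ring, ← two_mul, Gamma_add_nat_eq_poch_mul ha,
    Gamma_add_nat_eq_poch_mul h2]
  have := poch_ne_zero h2 n
  have := Complex.Gamma_ne_zero_of_re_pos h2
  field_simp

lemma chgM_mul_betaIntegral {a : ℂ} (ha : 0 < a.re) (z : ℂ) :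
    chgM a (2 * a) z * Complex.betaIntegral a a
      = ∫ s in (0 : ℝ)..1, Complex.exp (z * s) * poissonWeight a s := by
  have hw := intervalIntegrable_poissonWeight ha
  have key : HasSum (fun n : ℕ => ∫ s in (0 : ℝ)..1,
      ((z * s) ^ n / (n.factorial : ℂ)) * poissonWeight a s)
      (∫ s in (0 : ℝ)..1, Complex.exp (z * s) * poissonWeight a s) := by
    refine intervalIntegral.hasSum_integral_of_dominated_convergence
      (fun n s => ‖z‖ ^ n / (n.factorial : ℝ) * ‖poissonWeight a s‖) ?_ ?_ ?_ ?_ ?_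
    · intro n
      have : IntervalIntegrable (fun s : ℝ => ((z * s) ^ n / (n.factorial : ℂ))
          * poissonWeight a s) volume 0 1 :=
        hw.continuousOn_mul (by apply Continuous.continuousOn; fun_prop)
      exact this.def'.aestronglyMeasurable
    · intro n
      refine Eventually.of_forall fun s hs => ?_
      rw [uIoc_of_le zero_le_one] at hs
      rw [norm_mul, norm_div, norm_pow, norm_mul, Complex.norm_real, Complex.norm_natCast,
        Real.norm_eq_abs, abs_of_pos hs.1]
      have : ‖z‖ * s ≤ ‖z‖ := mul_le_of_le_one_right (norm_nonneg _) hs.2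
      have h0 : 0 ≤ ‖z‖ * s := mul_nonneg (norm_nonneg _) hs.1.le
      gcongr
    · exact Eventually.of_forall fun s _ => (Real.summable_pow_div_factorial ‖z‖).mul_right _
    · simp_rw [tsum_mul_right]
      exact hw.norm.const_mul _
    · refine Eventually.of_forall fun s _ => ?_
      have := NormedSpace.expSeries_div_hasSum_exp (z * s)
      rw [← Complex.exp_eq_exp_ℂ] at this
      exact this.mul_right _
  rw [← key.tsum_eq, chgM, ← tsum_mul_right]
  refine tsum_congr fun n => ?_
  have hterm : ∫ s in (0 : ℝ)..1, ((z * s) ^ n / (n.factorial : ℂ)) * poissonWeight a s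
      = z ^ n / (n.factorial : ℂ) * Complex.betaIntegral (a + n) a := by
    rw [Complex.betaIntegral, ← intervalIntegral.integral_const_mul]
    refine intervalIntegral.integral_congr_ae (Eventually.of_forall fun s hs => ?_)
    rw [uIoc_of_le zero_le_one] at hs
    have hs0 : (s : ℂ) ≠ 0 := by exact_mod_cast hs.1.ne'
    have : (s : ℂ) ^ (a + n - 1) = (s : ℂ) ^ n * (s : ℂ) ^ (a - 1) := by
      rw [show a + n - 1 = n + (a - 1) by ring, Complex.cpow_add _ _ hs0, Complex.cpow_natCast]
    simp only [poissonWeight]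
    rw [this]
    ring
  rw [hterm, betaIntegral_add_nat ha]
  have := poch_ne_zero (a := 2 * a) (by simpa using ha) n
  have : (n.factorial : ℂ) ≠ 0 := by exact_mod_cast n.factorial_ne_zero
  field_simp

/-- Poisson-type representation of `M_{0,γ}`. -/
lemma whittM_eq_poissonInt {γ : ℂ} (hγ : 0 < ((1 : ℂ) / 2 + γ).re) {x : ℝ} (hx : 0 < x) :
    whittM γ (2 * (x : ℂ)) = 2 ^ ((1 : ℂ) / 2 + γ) /
      Complex.betaIntegral ((1 : ℂ) / 2 + γ) ((1 : ℂ) / 2 + γ) *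
      ((x : ℂ) ^ ((1 : ℂ) / 2 + γ) * poissonInt ((1 : ℂ) / 2 + γ) 0 x) := by
  set a : ℂ := (1 : ℂ) / 2 + γ with ha
  have hb : Complex.betaIntegral a a ≠ 0 := by
    rw [Complex.betaIntegral_eq_Gamma_mul_div _ _ hγ hγ]
    have h1 := Complex.Gamma_ne_zero_of_re_pos hγ
    have h2 : 0 < (a + a).re := by simp only [Complex.add_re]; linarith
    have h2 := Complex.Gamma_ne_zero_of_re_pos h2
    positivity
  have h2a : 1 + 2 * γ = 2 * a := by rw [ha]; ring
  have h1 : (2 * (x : ℂ)) ^ a = 2 ^ a * (x : ℂ) ^ a := by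
    have := Complex.mul_cpow_ofReal_nonneg (zero_le_two) hx.le a
    simpa using this
  have h2 : Complex.exp (-(2 * (x : ℂ)) / 2) * (chgM a (2 * a) (2 * x) *
      Complex.betaIntegral a a) = poissonInt a 0 x := by
    rw [chgM_mul_betaIntegral hγ, ← intervalIntegral.integral_const_mul, poissonInt]
    refine intervalIntegral.integral_congr fun s _ => ?_
    simp only [pow_zero, one_mul]
    rw [← mul_assoc, ← Complex.exp_add]
    push_cast
    congr 2
    ring
  unfold whittM
  rw [← ha, h2a, h1, ← h2]
  field_simp

lemma norm_one_sub_cpow_le {a : ℂ} (ha : 0 < a.re) (ha1 : a.re ≤ 1) {t : ℝ}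
    (h1 : t ≤ 1 / 2) : ‖(1 - (t : ℂ)) ^ (a - 1)‖ ≤ 2 := by
  have hp : 0 < 1 - t := by linarith
  have : (1 - (t : ℂ)) = ((1 - t : ℝ) : ℂ) := by push_cast; ring
  rw [this, Complex.norm_cpow_eq_rpow_re_of_pos hp]
  calc (1 - t) ^ (a - 1).re ≤ (1 / 2 : ℝ) ^ (a - 1).re :=
        Real.rpow_le_rpow_of_nonpos (by norm_num) (by linarith) (by simp; linarith)
    _ ≤ (1 / 2 : ℝ) ^ (-1 : ℝ) :=
        Real.rpow_le_rpow_of_exponent_ge (by norm_num) (by norm_num) (by simp; linarith)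
    _ = 2 := by rw [Real.rpow_neg_one]; norm_num

lemma tendsto_integral_exp_mul_cpow {a : ℂ} (ha : 0 < a.re) (ha1 : a.re ≤ 1) :
    Tendsto (fun x : ℝ => ∫ v in Ioi (0 : ℝ), if v ≤ x then
      ((Real.exp (-v) : ℝ) : ℂ) * (v : ℂ) ^ (a - 1) * (1 - ((v / (2 * x) : ℝ) : ℂ)) ^ (a - 1)
      else 0) atTop (𝓝 (Complex.Gamma a)) := by
  rw [Complex.Gamma_eq_integral ha, Complex.GammaIntegral]
  refine tendsto_integral_filter_of_dominated_convergence
    (fun v => 2 * ‖((Real.exp (-v) : ℝ) : ℂ) * (v : ℂ) ^ (a - 1)‖) ?_ ?_ ?_ ?_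
  · refine Eventually.of_forall fun x => Measurable.aestronglyMeasurable ?_
    refine Measurable.ite measurableSet_Iic ?_ measurable_const
    fun_prop
  · filter_upwards [eventually_gt_atTop 0] with x hx
    refine (ae_restrict_iff' measurableSet_Ioi).2 (Eventually.of_forall fun v hv => ?_)
    rw [mem_Ioi] at hv
    split_ifs with h
    · rw [norm_mul, mul_comm]
      refine mul_le_mul_of_nonneg_right (norm_one_sub_cpow_le ha ha1 ?_)
        (norm_nonneg _)
      rw [div_le_div_iff₀ (by positivity) (by norm_num)]
      linarith
    · simp
  · exact (Complex.GammaIntegral_convergent ha).norm.const_mul 2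
  · refine (ae_restrict_iff' measurableSet_Ioi).2 (Eventually.of_forall fun v hv => ?_)
    have h1 : Tendsto (fun x : ℝ => v / (2 * x)) atTop (𝓝 0) :=
      (tendsto_id.const_mul_atTop (by norm_num : (0 : ℝ) < 2)).const_div_atTop v
    have h2 : Tendsto (fun x : ℝ => (1 - ((v / (2 * x) : ℝ) : ℂ)) ^ (a - 1)) atTop
        (𝓝 ((1 - ((0 : ℝ) : ℂ)) ^ (a - 1))) := by
      have hc : ContinuousAt (fun t : ℝ => (1 - (t : ℂ)) ^ (a - 1)) 0 := by
        refine ContinuousAt.cpow (by fun_prop) continuousAt_const ?_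
        simp
      exact hc.tendsto.comp h1
    simp only [Complex.ofReal_zero, sub_zero, Complex.one_cpow] at h2
    have h3 := h2.const_mul (((Real.exp (-v) : ℝ) : ℂ) * (v : ℂ) ^ (a - 1))
    rw [mul_one] at h3
    refine h3.congr' ?_
    filter_upwards [eventually_ge_atTop v] with x hx
    rw [if_pos hx]

lemma exp_neg_mul_poissonInt_zero {a : ℂ} (ha : 0 < a.re) {x : ℝ} (hx : 0 < x) :
    (x : ℂ) ^ a * ((Real.exp (-x) : ℝ) : ℂ) * poissonInt a 0 x =
      2 ^ (-a) * (∫ v in Ioi (0 : ℝ), if v ≤ x then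
      ((Real.exp (-v) : ℝ) : ℂ) * (v : ℂ) ^ (a - 1) * (1 - ((v / (2 * x) : ℝ) : ℂ)) ^ (a - 1)
      else 0) + (x : ℂ) ^ a * ∫ s in (1 / 2 : ℝ)..1,
        ((Real.exp (-(2 * x * s)) : ℝ) : ℂ) * poissonWeight a s := by
  have hint : IntervalIntegrable (fun s : ℝ => ((Real.exp (-(2 * x * s)) : ℝ) : ℂ)
      * poissonWeight a s) volume 0 1 :=
    (intervalIntegrable_poissonWeight ha).continuousOn_mul
      (by apply Continuous.continuousOn; fun_prop)
  have h1 : ((Real.exp (-x) : ℝ) : ℂ) * poissonInt a 0 x = ∫ s in (0 : ℝ)..1,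
      ((Real.exp (-(2 * x * s)) : ℝ) : ℂ) * poissonWeight a s := by
    rw [poissonInt, ← intervalIntegral.integral_const_mul]
    have := intervalIntegral.integral_comp_sub_left (a := 0) (b := 1)
      (fun s : ℝ => ((Real.exp (-(2 * x * s)) : ℝ) : ℂ) * poissonWeight a s) 1
    rw [sub_self, sub_zero] at this
    rw [← this]
    refine intervalIntegral.integral_congr fun s _ => ?_
    have hw : poissonWeight a (1 - s) = poissonWeight a s := by
      simp only [poissonWeight]
      push_cast
      rw [sub_sub_cancel, mul_comm]
    simp only [pow_zero, one_mul]
    rw [hw, ← mul_assoc, ← Complex.ofReal_mul, ← Real.exp_add]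
    congr 4
    ring
  have hsplit := intervalIntegral.integral_add_adjacent_intervals
    (hint.mono_set (c := 0) (d := 1 / 2) (by
      rw [uIcc_of_le (by norm_num), uIcc_of_le (by norm_num)]
      exact Icc_subset_Icc le_rfl (by norm_num)))
    (hint.mono_set (c := 1 / 2) (d := 1) (by
      rw [uIcc_of_le (by norm_num), uIcc_of_le (by norm_num)]
      exact Icc_subset_Icc (by norm_num) le_rfl))
  have hc := integral_comp_mul_left_Ioi (fun s : ℝ => if s ≤ 1 / 2 then
    ((Real.exp (-(2 * x * s)) : ℝ) : ℂ) * poissonWeight a s else 0) 0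
    (b := 1 / (2 * x)) (by positivity)
  rw [mul_zero] at hc
  have hset : ∫ s in Ioi (0 : ℝ), (if s ≤ 1 / 2 then
      ((Real.exp (-(2 * x * s)) : ℝ) : ℂ) * poissonWeight a s else 0) =
      ∫ s in (0 : ℝ)..(1 / 2), ((Real.exp (-(2 * x * s)) : ℝ) : ℂ) * poissonWeight a s := by
    rw [intervalIntegral.integral_of_le (by norm_num), ← Ioi_inter_Iic,
      ← setIntegral_indicator measurableSet_Iic]
    refine setIntegral_congr_fun measurableSet_Ioi fun s _ => ?_
    simp [indicator, mem_Iic]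
  rw [mul_assoc, h1, ← hsplit, mul_add, ← hset]
  congr 1
  have hx0 : (x : ℂ) ≠ 0 := by exact_mod_cast hx.ne'
  have h2x : (2 * x : ℂ) ≠ 0 := mul_ne_zero two_ne_zero hx0
  have hJ : ∫ s in Ioi (0 : ℝ), (if s ≤ 1 / 2 then
      ((Real.exp (-(2 * x * s)) : ℝ) : ℂ) * poissonWeight a s else 0) =
      (2 * x : ℂ)⁻¹ * ∫ v in Ioi (0 : ℝ), (if 1 / (2 * x) * v ≤ 1 / 2 then
      ((Real.exp (-(2 * x * (1 / (2 * x) * v))) : ℝ) : ℂ) * poissonWeight a (1 / (2 * x) * v)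
        else 0) := by
    have h1 : (2 * x : ℂ)⁻¹ * (((1 / (2 * x))⁻¹ : ℝ) : ℂ) = 1 := by
      push_cast
      field_simp
    rw [hc, Complex.real_smul, ← mul_assoc, h1, one_mul]
  rw [hJ, ← integral_const_mul, ← integral_const_mul, ← integral_const_mul]
  refine setIntegral_congr_fun measurableSet_Ioi fun v hv => ?_
  rw [mem_Ioi] at hv
  have hiff : 1 / (2 * x) * v ≤ 1 / 2 ↔ v ≤ x := by
    rw [one_div_mul_eq_div, div_le_div_iff₀ (by positivity) (by norm_num)]
    constructor <;> intro h <;> linarith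
  simp only [hiff]
  split_ifs with h
  · rw [show 2 * x * (1 / (2 * x) * v) = v by field_simp]
    have e1 : ((1 / (2 * x) * v : ℝ) : ℂ) ^ (a - 1)
        = ((2 * x : ℝ) : ℂ) ^ (-(a - 1)) * (v : ℂ) ^ (a - 1) := by
      rw [Complex.ofReal_mul, Complex.mul_cpow_ofReal_nonneg (by positivity) hv.le, one_div,
        Complex.ofReal_inv, Complex.inv_cpow _ _ ?_, Complex.cpow_neg]
      rw [Complex.arg_ofReal_of_nonneg (by positivity)]
      exact Real.pi_pos.ne
    have e2 : ((2 * x : ℝ) : ℂ) ^ (-(a - 1)) = 2 ^ (-a) * (x : ℂ) ^ (-a) * (2 * x) := by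
      rw [show -(a - 1) = -a + 1 by ring, Complex.cpow_add _ _ (by exact_mod_cast h2x),
        Complex.cpow_one, Complex.ofReal_mul,
        Complex.mul_cpow_ofReal_nonneg (by norm_num) hx.le]
      push_cast
      ring
    have e3 : (x : ℂ) ^ a * (x : ℂ) ^ (-a) = 1 := by
      rw [← Complex.cpow_add _ _ hx0]; simp
    simp only [poissonWeight]
    rw [e1, e2, show 1 / (2 * x) * v = v / (2 * x) by ring]
    have : (2 * x : ℂ)⁻¹ * (2 * x) = 1 := inv_mul_cancel₀ h2x
    set P := (1 - ((v / (2 * x) : ℝ) : ℂ)) ^ (a - 1)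
    set V := (v : ℂ) ^ (a - 1)
    set E := ((Real.exp (-v) : ℝ) : ℂ)
    calc _ = ((x : ℂ) ^ a * (x : ℂ) ^ (-a)) * ((2 * x : ℂ)⁻¹ * (2 * x)) *
          (2 ^ (-a) * (E * V * P)) := by ring
      _ = _ := by rw [e3, this]; ring
  · simp

lemma tendsto_exp_neg_mul_poissonInt_zero {a : ℂ} (ha : 0 < a.re) (ha1 : a.re ≤ 1) :
    Tendsto (fun x : ℝ => (x : ℂ) ^ a * ((Real.exp (-x) : ℝ) : ℂ) * poissonInt a 0 x) atTop
      (𝓝 (2 ^ (-a) * Complex.Gamma a)) := by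
  have h1 := (tendsto_integral_exp_mul_cpow ha ha1).const_mul (2 ^ (-a) : ℂ)
  have h2 : Tendsto (fun x : ℝ => (x : ℂ) ^ a * ∫ s in (1 / 2 : ℝ)..1,
        ((Real.exp (-(2 * x * s)) : ℝ) : ℂ) * poissonWeight a s) atTop (𝓝 0) := by
    have hb : Tendsto (fun x : ℝ => x ^ a.re * Real.exp (-1 * x) *
        ∫ s in (1 / 2 : ℝ)..1, ‖poissonWeight a s‖) atTop (𝓝 0) := by
      have := (tendsto_rpow_mul_exp_neg_mul_atTop_nhds_zero a.re 1 one_pos).mul_const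
        (∫ s in (1 / 2 : ℝ)..1, ‖poissonWeight a s‖)
      simpa using this
    refine squeeze_zero_norm' ?_ hb
    filter_upwards [eventually_gt_atTop 0] with x hx
    rw [norm_mul, Complex.norm_cpow_eq_rpow_re_of_pos hx, mul_assoc,
      ← intervalIntegral.integral_const_mul]
    refine mul_le_mul_of_nonneg_left ?_ (by positivity)
    refine intervalIntegral.norm_integral_le_of_norm_le (by norm_num) ?_ ?_
    · refine Eventually.of_forall fun s hs => ?_
      rw [norm_mul, Complex.norm_real, Real.norm_eq_abs, Real.abs_exp]
      gcongr
      nlinarith [hs.1]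
    · refine IntervalIntegrable.const_mul ?_ _
      refine (intervalIntegrable_poissonWeight ha).norm.mono_set ?_
      rw [uIcc_of_le (by norm_num), uIcc_of_le (by norm_num)]
      exact Icc_subset_Icc (by norm_num) le_rfl
  have h3 := h1.add h2
  rw [add_zero] at h3
  refine h3.congr' ?_
  filter_upwards [eventually_gt_atTop 0] with x hx
  exact (exp_neg_mul_poissonInt_zero ha hx).symm

lemma monotoneOn_Ici_of_hasDerivAt {f f' : ℝ → ℝ} {a : ℝ}
    (hf : ∀ x, a ≤ x → HasDerivAt f (f' x) x) (hf' : ∀ x, a ≤ x → 0 ≤ f' x) :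
    MonotoneOn f (Ici a) := by
  refine monotoneOn_of_deriv_nonneg (convex_Ici a)
    (fun x hx => (hf x hx).continuousAt.continuousWithinAt)
    (fun x hx => ?_) (fun x hx => ?_)
  all_goals
    rw [interior_Ici] at hx
  · exact (hf x (le_of_lt hx)).differentiableAt.differentiableWithinAt
  · rw [(hf x (le_of_lt hx)).deriv]
    exact hf' x (le_of_lt hx)

/-- A solution of `u'' = (1 - b/x²) u` with `u u' > 0` somewhere far out grows like `e^x`. -/
lemma mul_deriv_nonpos_of_isLittleO_exp {b R : ℝ} (hb : 0 < b) (hR : 0 < R) (hbR : 2 * b ≤ R ^ 2)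
    {u u1 : ℝ → ℝ} (hu : ∀ x, R ≤ x → HasDerivAt u (u1 x) x)
    (hu1 : ∀ x, R ≤ x → HasDerivAt u1 ((1 - b / x ^ 2) * u x) x)
    (hlim : Tendsto (fun x => Real.exp (-x) * u x) atTop (𝓝 0)) :
    ∀ x, R ≤ x → u x * u1 x ≤ 0 := by
  have hp : ∀ x, R ≤ x → 0 ≤ b / x ^ 2 ∧ b / x ^ 2 ≤ 1 / 2 := by
    intro x hx
    have hx0 : 0 < x := hR.trans_le hx
    refine ⟨by positivity, ?_⟩
    rw [div_le_div_iff₀ (by positivity) (by norm_num)]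
    nlinarith
  have hD : ∀ x, R ≤ x → HasDerivAt (fun x => u x * u1 x)
      (u1 x * u1 x + u x * ((1 - b / x ^ 2) * u x)) x := fun x hx => (hu x hx).mul (hu1 x hx)
  have hDlow : ∀ x, R ≤ x →
      (u x + u1 x) ^ 2 / 4 ≤ u1 x * u1 x + u x * ((1 - b / x ^ 2) * u x) := by
    intro x hx
    have := (hp x hx).2
    nlinarith [sq_nonneg (u x - u1 x), mul_nonneg (sub_nonneg.2 this) (sq_nonneg (u x)),
      sq_nonneg (u1 x)]
  have hDmono := monotoneOn_Ici_of_hasDerivAt hD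
    (fun x hx => (by positivity : (0 : ℝ) ≤ (u x + u1 x) ^ 2 / 4).trans (hDlow x hx))
  by_contra! hcon
  obtain ⟨x0, hx0R, hx0⟩ := hcon
  have hDpos : ∀ x, x0 ≤ x → 0 < u x * u1 x := fun x hx =>
    hx0.trans_le (hDmono (mem_Ici.2 hx0R) (mem_Ici.2 (hx0R.trans hx)) hx)
  set E : ℝ → ℝ := fun x => Real.exp (-2 * x - 2 * b * x⁻¹)
  have hE : ∀ x, x0 ≤ x → HasDerivAt E (E x * (-2 + 2 * (b / x ^ 2))) x := by
    intro x hx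
    have hx0 : x ≠ 0 := (hR.trans_le (hx0R.trans hx)).ne'
    have h := (((hasDerivAt_id x).const_mul (-2)).sub ((hasDerivAt_inv hx0).const_mul (2 * b))).exp
    refine h.congr_deriv ?_
    simp only [E, id, Pi.sub_apply]
    ring
  have hg : ∀ x, x0 ≤ x → HasDerivAt (fun x => (u x + u1 x) ^ 2 * E x)
      (2 * (b / x ^ 2) * E x * (u1 x ^ 2 + u x * u1 x)) x := by
    intro x hx
    have hR' := hx0R.trans hx
    refine ((((hu x hR').add (hu1 x hR')).pow 2).mul (hE x hx)).congr_deriv ?_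
    simp
    ring
  have hgmono := monotoneOn_Ici_of_hasDerivAt hg (fun x hx => by
    have := hDpos x hx
    have := (hp x (hx0R.trans hx)).1
    have : 0 < E x := Real.exp_pos _
    positivity)
  set c : ℝ := (u x0 + u1 x0) ^ 2 * E x0 with hc
  have hcpos : 0 < c := by
    have : 0 < E x0 := Real.exp_pos _
    have : 0 < (u x0 + u1 x0) ^ 2 := by nlinarith [sq_nonneg (u x0), sq_nonneg (u1 x0)]
    positivity
  have hf2 : ∀ x, x0 ≤ x → c * Real.exp (2 * x) ≤ (u x + u1 x) ^ 2 := by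
    intro x hx
    have h1 : c ≤ (u x + u1 x) ^ 2 * E x := hgmono (mem_Ici.2 le_rfl) (mem_Ici.2 hx) hx
    have hx0 : 0 < x := hR.trans_le (hx0R.trans hx)
    have h2 : E x ≤ Real.exp (-(2 * x)) := by
      apply Real.exp_le_exp.2
      have : 0 ≤ 2 * b * x⁻¹ := by positivity
      linarith
    calc c * Real.exp (2 * x) ≤ ((u x + u1 x) ^ 2 * Real.exp (-(2 * x))) * Real.exp (2 * x) := by
          gcongr
          exact h1.trans (by gcongr)
      _ = (u x + u1 x) ^ 2 := by rw [mul_assoc, ← Real.exp_add]; simp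
  have hexp : ∀ x : ℝ, HasDerivAt (fun x => Real.exp (2 * x)) (Real.exp (2 * x) * 2) x := by
    intro x
    simpa using ((hasDerivAt_id x).const_mul 2).exp
  have hD2 := monotoneOn_Ici_of_hasDerivAt (a := x0)
    (fun x hx => (hD x (hx0R.trans hx)).sub ((hexp x).const_mul (c / 8)))
    (fun x hx => by
      have h1 := hDlow x (hx0R.trans hx)
      have h2 := hf2 x hx
      linarith)
  set M : ℝ := c / 8 * Real.exp (2 * x0)
  have hD3 : ∀ x, x0 ≤ x → c / 8 * Real.exp (2 * x) - M ≤ u x * u1 x := by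
    intro x hx
    have := hD2 (mem_Ici.2 le_rfl) (mem_Ici.2 hx) hx
    simp only [Pi.sub_apply] at this
    simp only [M]
    linarith
  have hv := monotoneOn_Ici_of_hasDerivAt (a := x0)
    (fun x hx => (((hu x (hx0R.trans hx)).pow 2).sub ((hexp x).const_mul (c / 8))).add
      ((hasDerivAt_id x).const_mul (2 * M)))
    (fun x hx => by
      have := hD3 x hx
      simp
      linarith)
  set M' : ℝ := c / 8 * Real.exp (2 * x0) - 2 * M * x0
  have hv2 : ∀ x, x0 ≤ x → c / 8 * Real.exp (2 * x) - 2 * M * x - M' ≤ u x ^ 2 := by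
    intro x hx
    have := hv (mem_Ici.2 le_rfl) (mem_Ici.2 hx) hx
    simp only [Pi.sub_apply, Pi.add_apply, Pi.pow_apply, id] at this
    have := sq_nonneg (u x0)
    simp only [M']
    linarith
  have hl1 : Tendsto (fun x => (Real.exp (-x) * u x) ^ 2) atTop (𝓝 0) := by
    simpa using hlim.pow 2
  have hl2 : Tendsto (fun x : ℝ => c / 8 - 2 * M * (x * Real.exp (-2 * x))
      - M' * Real.exp (-2 * x)) atTop (𝓝 (c / 8)) := by
    have h1 : Tendsto (fun x : ℝ => x * Real.exp (-2 * x)) atTop (𝓝 0) := by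
      simpa using tendsto_rpow_mul_exp_neg_mul_atTop_nhds_zero 1 2 two_pos
    have h2 : Tendsto (fun x : ℝ => Real.exp (-2 * x)) atTop (𝓝 0) := by
      simpa using tendsto_rpow_mul_exp_neg_mul_atTop_nhds_zero 0 2 two_pos
    simpa using ((h1.const_mul (2 * M)).const_sub (c / 8)).sub (h2.const_mul M')
  have hle : c / 8 ≤ 0 := by
    refine le_of_tendsto_of_tendsto hl2 hl1 ?_
    filter_upwards [eventually_ge_atTop x0] with x hx
    have h1 := hv2 x hx
    have h2 : Real.exp (-2 * x) * Real.exp (2 * x) = 1 := by rw [← Real.exp_add]; simp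
    have h3 : Real.exp (-x) ^ 2 = Real.exp (-2 * x) := by
      rw [← Real.exp_nat_mul]; congr 1; push_cast; ring
    have h4 := mul_le_mul_of_nonneg_left h1 (Real.exp_pos (-2 * x)).le
    rw [mul_pow, h3]
    calc _ = Real.exp (-2 * x) * (c / 8 * Real.exp (2 * x) - 2 * M * x - M')
          + (c / 8) * (1 - Real.exp (-2 * x) * Real.exp (2 * x)) := by ring
      _ ≤ _ := by rw [h2]; linarith
  linarith

lemma exp_decay_of_mul_deriv_nonpos {b R : ℝ} (hb : 0 < b) (hR : 0 < R) (hbR : 2 * b ≤ R ^ 2)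
    {u u1 : ℝ → ℝ} (hu : ∀ x, R ≤ x → HasDerivAt u (u1 x) x)
    (hu1 : ∀ x, R ≤ x → HasDerivAt u1 ((1 - b / x ^ 2) * u x) x)
    (hneg : ∀ x, R ≤ x → u x * u1 x ≤ 0) :
    ∃ K, 0 ≤ K ∧ ∀ x, R + 1 ≤ x →
      |u x| ≤ K * Real.exp (-(x / 2)) ∧ |u1 x| ≤ K * Real.exp (-(x / 2)) := by
  have hp : ∀ x, R ≤ x → 0 ≤ b / x ^ 2 ∧ b / x ^ 2 ≤ 1 / 2 := by
    intro x hx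
    have hx0 : 0 < x := hR.trans_le hx
    refine ⟨by positivity, ?_⟩
    rw [div_le_div_iff₀ (by positivity) (by norm_num)]
    nlinarith
  have hD : ∀ x, R ≤ x → HasDerivAt (fun x => u x * u1 x)
      (u1 x * u1 x + u x * ((1 - b / x ^ 2) * u x)) x := fun x hx => (hu x hx).mul (hu1 x hx)
  have hDlow : ∀ x, R ≤ x →
      (u x ^ 2 + u1 x ^ 2) / 2 ≤ u1 x * u1 x + u x * ((1 - b / x ^ 2) * u x) := by
    intro x hx
    have := (hp x hx).2
    nlinarith [mul_nonneg (sub_nonneg.2 this) (sq_nonneg (u x)), sq_nonneg (u1 x)]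
  have hPe := monotoneOn_Ici_of_hasDerivAt (a := R)
    (fun x hx => (hD x hx).mul (Real.hasDerivAt_exp x)) (fun x hx => by
      have h1 := hDlow x hx
      have h2 : 0 ≤ u1 x * u1 x + u x * ((1 - b / x ^ 2) * u x) + u x * u1 x := by
        nlinarith [sq_nonneg (u x + u1 x)]
      have := mul_nonneg h2 (Real.exp_pos x).le
      linarith)
  have hS := monotoneOn_Ici_of_hasDerivAt (a := R)
    (fun x hx => (((hu x hx).pow 2).add ((hu1 x hx).pow 2)).neg) (fun x hx => by
      have h1 := hneg x hx
      have h2 := hp x hx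
      simp
      nlinarith [mul_nonneg (neg_nonneg.2 h1) (by linarith : 0 ≤ 2 - b / x ^ 2)])
  set A : ℝ := -(u R * u1 R) * Real.exp R
  have hA : 0 ≤ A := mul_nonneg (neg_nonneg.2 (hneg R le_rfl)) (Real.exp_pos _).le
  have hP : ∀ x, R ≤ x → -(u x * u1 x) ≤ A * Real.exp (-x) := by
    intro x hx
    have := hPe (mem_Ici.2 le_rfl) (mem_Ici.2 hx) hx
    simp only [Pi.mul_apply] at this
    have h2 : -(u x * u1 x) * Real.exp x ≤ A := by simp only [A]; linarith
    have h3 := mul_le_mul_of_nonneg_right h2 (Real.exp_pos (-x)).le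
    rwa [mul_assoc, ← Real.exp_add, add_neg_cancel, Real.exp_zero, mul_one] at h3
  have hmain : ∀ x, R + 1 ≤ x →
      u x ^ 2 + u1 x ^ 2 ≤ (2 * A * Real.exp 1) * Real.exp (-(x / 2)) ^ 2 := by
    intro x hx
    have hlt : x - 1 < x := by linarith
    have hR1 : R ≤ x - 1 := by linarith
    obtain ⟨ξ, hξ, hξe⟩ := exists_hasDerivAt_eq_slope (fun x => u x * u1 x) _ hlt
      (fun y hy => (hD y (hR1.trans hy.1)).continuousAt.continuousWithinAt)
      (fun y hy => hD y (hR1.trans hy.1.le))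
    rw [sub_sub_cancel, div_one] at hξe
    have hξR := hR1.trans hξ.1.le
    have h1 := hDlow ξ hξR
    have h2 := hS (mem_Ici.2 hξR) (mem_Ici.2 (hξR.trans hξ.2.le)) hξ.2.le
    have h3 := hP (x - 1) hR1
    have h4 := hneg x (by linarith)
    simp only [Pi.neg_apply, Pi.add_apply, Pi.pow_apply] at h2
    have h5 : Real.exp (-(x - 1)) = Real.exp 1 * Real.exp (-(x / 2)) ^ 2 := by
      rw [← Real.exp_nat_mul, ← Real.exp_add]; congr 1; push_cast; ring
    rw [h5] at h3
    nlinarith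
  refine ⟨Real.sqrt (2 * A * Real.exp 1), Real.sqrt_nonneg _, fun x hx => ?_⟩
  have hK : 0 ≤ 2 * A * Real.exp 1 := by positivity
  have h := hmain x hx
  rw [← Real.sq_sqrt hK, ← mul_pow] at h
  constructor
  · refine abs_le_of_sq_le_sq (by nlinarith [sq_nonneg (u1 x)]) (by positivity)
  · refine abs_le_of_sq_le_sq (by nlinarith [sq_nonneg (u x)]) (by positivity)

/-- Complex solutions of `w'' = (1 - b/x²) w` that are `o(e^x)` decay exponentially. -/
lemma exp_decay_of_isLittleO_exp {b : ℝ} (hb : 0 < b) {w w1 : ℝ → ℂ}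
    (hw : ∀ x, 0 < x → HasDerivAt w (w1 x) x)
    (hw1 : ∀ x, 0 < x → HasDerivAt w1 (((1 - b / x ^ 2 : ℝ) : ℂ) * w x) x)
    (hlim : Tendsto (fun x => ((Real.exp (-x) : ℝ) : ℂ) * w x) atTop (𝓝 0)) :
    ∃ K R, 0 ≤ K ∧ 1 ≤ R ∧ ∀ x, R ≤ x →
      ‖w x‖ ≤ K * Real.exp (-(x / 2)) ∧ ‖w1 x‖ ≤ K * Real.exp (-(x / 2)) := by
  set R : ℝ := 1 + 2 * b
  have hR : 0 < R := by positivity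
  have hbR : 2 * b ≤ R ^ 2 := by simp only [R]; nlinarith
  have hre : ∀ x, R ≤ x → HasDerivAt (fun x => (w x).re) (w1 x).re x := fun x hx =>
    Complex.reCLM.hasFDerivAt.comp_hasDerivAt x (hw x (hR.trans_le hx))
  have him : ∀ x, R ≤ x → HasDerivAt (fun x => (w x).im) (w1 x).im x := fun x hx =>
    Complex.imCLM.hasFDerivAt.comp_hasDerivAt x (hw x (hR.trans_le hx))
  have hre1 : ∀ x, R ≤ x → HasDerivAt (fun x => (w1 x).re) ((1 - b / x ^ 2) * (w x).re) x :=
    fun x hx => by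
      have := Complex.reCLM.hasFDerivAt.comp_hasDerivAt x (hw1 x (hR.trans_le hx))
      rwa [Complex.reCLM_apply, Complex.re_ofReal_mul] at this
  have him1 : ∀ x, R ≤ x → HasDerivAt (fun x => (w1 x).im) ((1 - b / x ^ 2) * (w x).im) x :=
    fun x hx => by
      have := Complex.imCLM.hasFDerivAt.comp_hasDerivAt x (hw1 x (hR.trans_le hx))
      rwa [Complex.imCLM_apply, Complex.im_ofReal_mul] at this
  have lre : Tendsto (fun x => Real.exp (-x) * (w x).re) atTop (𝓝 0) := by
    have := (Complex.continuous_re.tendsto 0).comp hlim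
    simpa only [Function.comp_def, Complex.re_ofReal_mul, Complex.zero_re] using this
  have lim : Tendsto (fun x => Real.exp (-x) * (w x).im) atTop (𝓝 0) := by
    have := (Complex.continuous_im.tendsto 0).comp hlim
    simpa only [Function.comp_def, Complex.im_ofReal_mul, Complex.zero_im] using this
  obtain ⟨K1, hK1, h1⟩ := exp_decay_of_mul_deriv_nonpos hb hR hbR hre hre1
    (mul_deriv_nonpos_of_isLittleO_exp hb hR hbR hre hre1 lre)
  obtain ⟨K2, hK2, h2⟩ := exp_decay_of_mul_deriv_nonpos hb hR hbR him him1
    (mul_deriv_nonpos_of_isLittleO_exp hb hR hbR him him1 lim)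
  refine ⟨K1 + K2, R + 1, by positivity, by linarith, fun x hx => ⟨?_, ?_⟩⟩
  · have := Complex.norm_le_abs_re_add_abs_im (w x)
    linarith [(h1 x hx).1, (h2 x hx).1]
  · have := Complex.norm_le_abs_re_add_abs_im (w1 x)
    linarith [(h1 x hx).2, (h2 x hx).2]

/-- The solution `x^a ∫₀¹ e^{x(2s-1)} (s(1-s))^{a-1} ds` of the Whittaker equation with second derivative
`(1 + a(a-1)/x²) w`. -/
def poissonSol (a : ℂ) (x : ℝ) : ℂ := (x : ℂ) ^ a * poissonInt a 0 x

/-- The derivative of `poissonSol`. -/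
def poissonSolDeriv (a : ℂ) (x : ℝ) : ℂ :=
  a * (x : ℂ) ^ (a - 1) * poissonInt a 0 x + (x : ℂ) ^ a * poissonInt a 1 x

lemma hasDerivAt_ofReal_cpow_of_pos (c : ℂ) {x : ℝ} (hx : 0 < x) :
    HasDerivAt (fun x : ℝ => (x : ℂ) ^ c) (c * (x : ℂ) ^ (c - 1)) x := by
  have := ((hasDerivAt_id (x : ℂ)).cpow_const (c := c) (Or.inl (by simpa using hx))).comp_ofReal
  simpa using this

lemma hasDerivAt_poissonSol {a : ℂ} (ha : 0 < a.re) {x : ℝ} (hx : 0 < x) :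
    HasDerivAt (poissonSol a) (poissonSolDeriv a x) x :=
  (hasDerivAt_ofReal_cpow_of_pos a hx).mul (hasDerivAt_poissonInt ha 0 x)

lemma hasDerivAt_poissonSolDeriv {a : ℂ} (ha : 0 < a.re) {b : ℝ} (hab : a * (a - 1) = -b)
    {x : ℝ} (hx : 0 < x) :
    HasDerivAt (poissonSolDeriv a) (((1 - b / x ^ 2 : ℝ) : ℂ) * poissonSol a x) x := by
  have hx0 : (x : ℂ) ≠ 0 := by exact_mod_cast hx.ne'
  have h := ((((hasDerivAt_ofReal_cpow_of_pos (a - 1) hx).const_mul a).mul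
    (hasDerivAt_poissonInt ha 0 x)).add
    ((hasDerivAt_ofReal_cpow_of_pos a hx).mul (hasDerivAt_poissonInt ha 1 x)))
  refine h.congr_deriv ?_
  have hrec := poissonInt_recurrence ha x
  have p1 : (x : ℂ) ^ a = (x : ℂ) ^ (a - 1 - 1) * x ^ 2 := by
    rw [show a = (a - 1 - 1) + (2 : ℕ) by push_cast; ring, Complex.cpow_add _ _ hx0,
      Complex.cpow_natCast]
    ring_nf
  have p2 : (x : ℂ) ^ (a - 1) = (x : ℂ) ^ (a - 1 - 1) * x := by
    conv_lhs => rw [show a - 1 = (a - 1 - 1) + 1 by ring, Complex.cpow_add _ _ hx0,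
      Complex.cpow_one]
  simp only [poissonSol, zero_add, Nat.reduceAdd]
  rw [p1, p2]
  have e : (x : ℂ) ^ 2 * ((1 - b / x ^ 2 : ℝ) : ℂ) = x ^ 2 - b := by
    push_cast
    field_simp
  set P := (x : ℂ) ^ (a - 1 - 1)
  linear_combination (-(P * x)) * hrec + (P * poissonInt a 0 x) * hab -
    (P * poissonInt a 0 x) * e

lemma norm_poissonSol_le {a : ℂ} (ha : 0 < a.re) {κ R : ℝ} (hκ : κ ≤ a.re) (hR : 1 ≤ R) :
    ∃ K, 0 ≤ K ∧ ∀ x, 0 < x → x ≤ R →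
      ‖poissonSol a x‖ ≤ K * x ^ κ ∧ ‖poissonSolDeriv a x‖ ≤ K * x ^ (κ - 1) := by
  set B : ℝ := ∫ s in (0 : ℝ)..1, ‖poissonWeight a s‖
  have hB : 0 ≤ B := intervalIntegral.integral_nonneg zero_le_one fun _ _ => norm_nonneg _
  set L : ℝ := R ^ (a.re - κ)
  have hL : 0 ≤ L := by positivity
  set E : ℝ := Real.exp R * B
  have hE : 0 ≤ E := by positivity
  have hint : ∀ k x, 0 < x → x ≤ R → ‖poissonInt a k x‖ ≤ E := fun k x hx hxR =>
    (norm_poissonInt_le ha k hx.le).trans (by simp only [E]; gcongr)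
  have hpow : ∀ x, 0 < x → x ≤ R → x ^ a.re ≤ L * x ^ κ := by
    intro x hx hxR
    calc x ^ a.re = x ^ (a.re - κ) * x ^ κ := by rw [← Real.rpow_add hx]; ring_nf
      _ ≤ L * x ^ κ :=
        mul_le_mul_of_nonneg_right (Real.rpow_le_rpow hx.le hxR (by linarith)) (by positivity)
  have hpow1 : ∀ x, 0 < x → x ≤ R → x ^ (a.re - 1) ≤ L * x ^ (κ - 1) := by
    intro x hx hxR
    rw [Real.rpow_sub_one hx.ne', Real.rpow_sub_one hx.ne', ← mul_div_assoc]
    gcongr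
    exact hpow x hx hxR
  refine ⟨L * E + ‖a‖ * (L * E) + R * L * E, by positivity, fun x hx hxR => ⟨?_, ?_⟩⟩
  · rw [poissonSol, norm_mul, Complex.norm_cpow_eq_rpow_re_of_pos hx]
    calc x ^ a.re * ‖poissonInt a 0 x‖ ≤ (L * x ^ κ) * E :=
          mul_le_mul (hpow x hx hxR) (hint 0 x hx hxR) (norm_nonneg _) (by positivity)
      _ = (L * E) * x ^ κ := by ring
      _ ≤ _ := by
        gcongr
        have : 0 ≤ ‖a‖ * (L * E) + R * L * E := by positivity
        linarith
  · have hxx : x ^ a.re ≤ R * (L * x ^ (κ - 1)) := by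
      calc x ^ a.re = x * x ^ (a.re - 1) := by rw [Real.rpow_sub_one hx.ne']; field_simp
        _ ≤ R * (L * x ^ (κ - 1)) := by
          have := hpow1 x hx hxR
          gcongr
    rw [poissonSolDeriv]
    refine (norm_add_le _ _).trans ?_
    rw [norm_mul, norm_mul, norm_mul, Complex.norm_cpow_eq_rpow_re_of_pos hx,
      Complex.norm_cpow_eq_rpow_re_of_pos hx]
    have h1 : (a - 1).re = a.re - 1 := by simp
    rw [h1]
    calc ‖a‖ * x ^ (a.re - 1) * ‖poissonInt a 0 x‖ + x ^ a.re * ‖poissonInt a 1 x‖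
        ≤ ‖a‖ * (L * x ^ (κ - 1)) * E + R * (L * x ^ (κ - 1)) * E := by
          have := hpow1 x hx hxR
          have := hint 0 x hx hxR
          have := hint 1 x hx hxR
          gcongr
      _ = (‖a‖ * (L * E) + R * L * E) * x ^ (κ - 1) := by ring
      _ ≤ _ := by
        gcongr
        have : 0 ≤ L * E := by positivity
        linarith

/-- Connection of the two expansions: `W_{0,γ}(2x)` is a combination of Poisson integrals. -/
lemma whittW_eq_poissonSol {γ : ℂ} (h1 : 0 < ((1 : ℂ) / 2 + γ).re)
    (h2 : 0 < ((1 : ℂ) / 2 + -γ).re) (hγ : γ ≠ 0) :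
    ∃ A B : ℂ, (∀ x : ℝ, 0 < x → whittW γ (2 * (x : ℂ)) =
      A * poissonSol ((1 : ℂ) / 2 + γ) x + B * poissonSol ((1 : ℂ) / 2 + -γ) x) ∧
      A * (2 ^ (-((1 : ℂ) / 2 + γ)) * Complex.Gamma ((1 : ℂ) / 2 + γ)) +
      B * (2 ^ (-((1 : ℂ) / 2 + -γ)) * Complex.Gamma ((1 : ℂ) / 2 + -γ)) = 0 := by
  refine ⟨Complex.Gamma (-(2 * γ)) / Complex.Gamma ((1 : ℂ) / 2 - γ) *
    (2 ^ ((1 : ℂ) / 2 + γ) /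
      Complex.betaIntegral ((1 : ℂ) / 2 + γ) ((1 : ℂ) / 2 + γ)),
    Complex.Gamma (2 * γ) / Complex.Gamma ((1 : ℂ) / 2 + γ) *
    (2 ^ ((1 : ℂ) / 2 + -γ) /
      Complex.betaIntegral ((1 : ℂ) / 2 + -γ) ((1 : ℂ) / 2 + -γ)), fun x hx => ?_, ?_⟩
  · rw [whittW, whittM_eq_poissonInt h1 hx, whittM_eq_poissonInt h2 hx, poissonSol, poissonSol]
    ring
  · rw [Complex.betaIntegral_eq_Gamma_mul_div _ _ h1 h1,
      Complex.betaIntegral_eq_Gamma_mul_div _ _ h2 h2,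
      show (1 : ℂ) / 2 + γ + (1 / 2 + γ) = 2 * γ + 1 by ring,
      show (1 : ℂ) / 2 + -γ + (1 / 2 + -γ) = -(2 * γ) + 1 by ring,
      Complex.Gamma_add_one _ (by simpa using hγ), Complex.Gamma_add_one _ (by simpa using hγ),
      sub_eq_add_neg]
    have g1 := Complex.Gamma_ne_zero_of_re_pos h1
    have g2 := Complex.Gamma_ne_zero_of_re_pos h2
    have t : ∀ z : ℂ, (2 : ℂ) ^ z * 2 ^ (-z) = 1 := fun z => by
      rw [← Complex.cpow_add _ _ two_ne_zero]; simp
    have t1 := t ((1 : ℂ) / 2 + γ)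
    have t2 := t ((1 : ℂ) / 2 + -γ)
    generalize (2 : ℂ) ^ ((1 : ℂ) / 2 + γ) = p1 at *
    generalize (2 : ℂ) ^ (-((1 : ℂ) / 2 + γ)) = q1 at *
    generalize (2 : ℂ) ^ ((1 : ℂ) / 2 + -γ) = p2 at *
    generalize (2 : ℂ) ^ (-((1 : ℂ) / 2 + -γ)) = q2 at *
    generalize Complex.Gamma ((1 : ℂ) / 2 + γ) = G1 at *
    generalize Complex.Gamma ((1 : ℂ) / 2 + -γ) = G2 at *
    generalize Complex.Gamma (-(2 * γ)) = H1
    generalize Complex.Gamma (2 * γ) = H2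
    have e1 : H1 / G2 * (p1 / (G1 * G1 / (2 * γ * H2))) * (q1 * G1)
        = (p1 * q1) * (H1 * (2 * γ * H2) / (G1 * G2)) := by
      rw [div_div_eq_mul_div]
      field_simp
    have e2 : H2 / G1 * (p2 / (G2 * G2 / (-(2 * γ) * H1))) * (q2 * G2)
        = (p2 * q2) * (H2 * (-(2 * γ) * H1) / (G1 * G2)) := by
      rw [div_div_eq_mul_div]
      field_simp
    rw [e1, e2, t1, t2]
    ring

/-- Pointwise bounds for `x ↦ W_{0,γ}(2x)` and its first two derivatives. -/
theorem whittW_bounds {γ : ℂ} {b : ℝ} (hb : 0 < b) (hγb : γ ^ 2 = ((1 / 4 - b : ℝ) : ℂ))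
    (hγ : γ ≠ 0) (hre0 : 0 ≤ γ.re) (hre : γ.re < 1 / 2) :
    ∃ (w1 w2 : ℝ → ℂ) (K : ℝ), 0 ≤ K ∧
      (∀ x, 0 < x → HasDerivAt (fun x : ℝ => whittW γ (2 * (x : ℂ))) (w1 x) x) ∧
      (∀ x, 0 < x → HasDerivAt w1 (w2 x) x) ∧ ContinuousOn w2 (Ioi 0) ∧
      (∀ x : ℝ, 0 < x →
        ‖whittW γ (2 * (x : ℂ))‖ ≤ K * (x ^ (1 / 2 - γ.re) * Real.exp (-(x / 8)))) ∧
      (∀ x, 0 < x → ‖w1 x‖ ≤ K * (x ^ (1 / 2 - γ.re - 1) * Real.exp (-(x / 8)))) ∧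
      (∀ x, 0 < x → ‖w2 x‖ ≤ K * x ^ (1 / 2 - γ.re - 2)) := by
  have h1 : 0 < ((1 : ℂ) / 2 + γ).re := by simp; linarith
  have h2 : 0 < ((1 : ℂ) / 2 + -γ).re := by simp; linarith
  have h1' : ((1 : ℂ) / 2 + γ).re ≤ 1 := by simp; linarith
  have h2' : ((1 : ℂ) / 2 + -γ).re ≤ 1 := by simp; linarith
  obtain ⟨A, B, hAB, hcancel⟩ := whittW_eq_poissonSol h1 h2 hγ
  set a1 : ℂ := (1 : ℂ) / 2 + γ with ha1
  set a2 : ℂ := (1 : ℂ) / 2 + -γ with ha2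
  have hab1 : a1 * (a1 - 1) = -b := by
    rw [ha1]; push_cast at hγb; linear_combination hγb
  have hab2 : a2 * (a2 - 1) = -b := by
    rw [ha2]; push_cast at hγb; linear_combination hγb
  set w : ℝ → ℂ := fun x => whittW γ (2 * (x : ℂ)) with hw_def
  set w1 : ℝ → ℂ := fun x => A * poissonSolDeriv a1 x + B * poissonSolDeriv a2 x
  set w2 : ℝ → ℂ := fun x => ((1 - b / x ^ 2 : ℝ) : ℂ) * w x
  have hw : ∀ x, 0 < x → HasDerivAt w (w1 x) x := by
    intro x hx
    refine (((hasDerivAt_poissonSol h1 hx).const_mul A).add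
      ((hasDerivAt_poissonSol h2 hx).const_mul B)).congr_of_eventuallyEq ?_
    filter_upwards [Ioi_mem_nhds hx] with y hy
    exact hAB y hy
  have hw1 : ∀ x, 0 < x → HasDerivAt w1 (w2 x) x := by
    intro x hx
    refine (((hasDerivAt_poissonSolDeriv h1 hab1 hx).const_mul A).add
      ((hasDerivAt_poissonSolDeriv h2 hab2 hx).const_mul B)).congr_deriv ?_
    simp only [w2, w]
    rw [hAB x hx]
    ring
  have hlim : Tendsto (fun x => ((Real.exp (-x) : ℝ) : ℂ) * w x) atTop (𝓝 0) := by
    have := ((tendsto_exp_neg_mul_poissonInt_zero h1 h1').const_mul A).add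
      ((tendsto_exp_neg_mul_poissonInt_zero h2 h2').const_mul B)
    rw [hcancel] at this
    refine this.congr' ?_
    filter_upwards [eventually_gt_atTop 0] with x hx
    simp only [w]
    rw [hAB x hx, poissonSol, poissonSol]
    ring
  obtain ⟨K0, R, hK0, hR, hdecay⟩ := exp_decay_of_isLittleO_exp hb hw hw1 hlim
  set κ : ℝ := 1 / 2 - γ.re with hκ
  have hκ0 : 0 < κ := by linarith
  have hκ1 : κ ≤ 1 / 2 := by linarith
  obtain ⟨K1, hK1, hb1⟩ := norm_poissonSol_le h1 (κ := κ) (by simp [ha1]; linarith) hR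
  obtain ⟨K2, hK2, hb2⟩ := norm_poissonSol_le h2 (κ := κ) (by simp [ha2]; linarith) hR
  set C : ℝ := (‖A‖ * K1 + ‖B‖ * K2) * Real.exp (R / 8) + 8 * K0 with hC
  have hC0 : 0 ≤ C := by positivity
  have hsmall : ∀ x : ℝ, x ≤ R → 1 ≤ Real.exp (R / 8) * Real.exp (-(x / 8)) := by
    intro x hx
    rw [← Real.exp_add]
    exact Real.one_le_exp (by linarith)
  have hlarge : ∀ x : ℝ, Real.exp (-(x / 2)) * x ≤ 8 * Real.exp (-(x / 8)) := by
    intro x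
    have h3 : x / 8 ≤ Real.exp (x / 8) := by linarith [Real.add_one_le_exp (x / 8)]
    by_cases hx : 0 ≤ x
    · have h4 : Real.exp (-(x / 2)) ≤ Real.exp (-(x / 8)) * Real.exp (-(x / 8)) := by
        rw [← Real.exp_add]; apply Real.exp_le_exp.2; linarith
      calc Real.exp (-(x / 2)) * x ≤ Real.exp (-(x / 8)) * Real.exp (-(x / 8)) *
            (8 * Real.exp (x / 8)) := by gcongr; linarith
        _ = 8 * Real.exp (-(x / 8)) * (Real.exp (-(x / 8)) * Real.exp (x / 8)) := by ring
        _ = _ := by rw [← Real.exp_add]; simp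
    · push Not at hx
      exact (mul_nonpos_of_nonneg_of_nonpos (Real.exp_pos _).le hx.le).trans (by positivity)
  have hbw : ∀ x, 0 < x → ‖w x‖ ≤ C * (x ^ κ * Real.exp (-(x / 8))) := by
    intro x hx
    rcases le_total x R with hxR | hxR
    · calc ‖w x‖ ≤ ‖A‖ * (K1 * x ^ κ) + ‖B‖ * (K2 * x ^ κ) := by
            simp only [w]
            rw [hAB x hx]
            refine (norm_add_le _ _).trans ?_
            rw [norm_mul, norm_mul]
            gcongr
            · exact (hb1 x hx hxR).1
            · exact (hb2 x hx hxR).1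
        _ = (‖A‖ * K1 + ‖B‖ * K2) * 1 * x ^ κ := by ring
        _ ≤ (‖A‖ * K1 + ‖B‖ * K2) * (Real.exp (R / 8) * Real.exp (-(x / 8))) * x ^ κ := by
            gcongr
            exact hsmall x hxR
        _ = ((‖A‖ * K1 + ‖B‖ * K2) * Real.exp (R / 8)) * (x ^ κ * Real.exp (-(x / 8))) := by ring
        _ ≤ _ := by
            gcongr
            linarith
    · have hx1 : 1 ≤ x := hR.trans hxR
      calc ‖w x‖ ≤ K0 * Real.exp (-(x / 2)) := (hdecay x hxR).1
        _ ≤ K0 * (1 * Real.exp (-(x / 8))) := by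
            rw [one_mul]
            gcongr
            norm_num
        _ ≤ K0 * (x ^ κ * Real.exp (-(x / 8))) := by
            gcongr
            exact Real.one_le_rpow hx1 hκ0.le
        _ ≤ _ := by
            gcongr
            have : 0 ≤ (‖A‖ * K1 + ‖B‖ * K2) * Real.exp (R / 8) := by positivity
            linarith
  have hbw1 : ∀ x, 0 < x → ‖w1 x‖ ≤ C * (x ^ (κ - 1) * Real.exp (-(x / 8))) := by
    intro x hx
    rcases le_total x R with hxR | hxR
    · calc ‖w1 x‖ ≤ ‖A‖ * (K1 * x ^ (κ - 1)) + ‖B‖ * (K2 * x ^ (κ - 1)) := by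
            simp only [w1]
            refine (norm_add_le _ _).trans ?_
            rw [norm_mul, norm_mul]
            gcongr
            · exact (hb1 x hx hxR).2
            · exact (hb2 x hx hxR).2
        _ = (‖A‖ * K1 + ‖B‖ * K2) * 1 * x ^ (κ - 1) := by ring
        _ ≤ (‖A‖ * K1 + ‖B‖ * K2) * (Real.exp (R / 8) * Real.exp (-(x / 8))) * x ^ (κ - 1) := by
            gcongr
            exact hsmall x hxR
        _ = ((‖A‖ * K1 + ‖B‖ * K2) * Real.exp (R / 8)) * (x ^ (κ - 1) * Real.exp (-(x / 8))) := by
            ring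
        _ ≤ _ := by
            gcongr
            linarith
    · have hx1 : 1 ≤ x := hR.trans hxR
      have hpow : 1 ≤ x * x ^ (κ - 1) := by
        rw [Real.rpow_sub_one hx.ne', mul_div_cancel₀ _ hx.ne']
        exact Real.one_le_rpow hx1 hκ0.le
      calc ‖w1 x‖ ≤ K0 * Real.exp (-(x / 2)) := (hdecay x hxR).2
        _ ≤ K0 * Real.exp (-(x / 2)) * (x * x ^ (κ - 1)) :=
            le_mul_of_one_le_right (by positivity) hpow
        _ = K0 * (Real.exp (-(x / 2)) * x) * x ^ (κ - 1) := by ring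
        _ ≤ K0 * (8 * Real.exp (-(x / 8))) * x ^ (κ - 1) := 
            mul_le_mul_of_nonneg_right (mul_le_mul_of_nonneg_left (hlarge x) hK0) (by positivity)
        _ = 8 * K0 * (x ^ (κ - 1) * Real.exp (-(x / 8))) := by ring
        _ ≤ _ := by
            gcongr
            have : 0 ≤ (‖A‖ * K1 + ‖B‖ * K2) * Real.exp (R / 8) := by positivity
            linarith
  refine ⟨w1, w2, C * (1 + b + 128), by positivity, hw, hw1, ?_, ?_, ?_, ?_⟩
  · intro x hx
    rw [mem_Ioi] at hx
    refine ContinuousAt.continuousWithinAt (ContinuousAt.mul ?_ (hw x hx).continuousAt)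
    refine Complex.continuous_ofReal.continuousAt.comp ?_
    refine continuousAt_const.sub (continuousAt_const.div (by fun_prop) (by positivity))
  · intro x hx
    refine (hbw x hx).trans ?_
    gcongr
    exact le_mul_of_one_le_right hC0 (by linarith)
  · intro x hx
    refine (hbw1 x hx).trans ?_
    gcongr
    exact le_mul_of_one_le_right hC0 (by linarith)
  · intro x hx
    have e1 : |1 - b / x ^ 2| ≤ (x ^ 2 + b) / x ^ 2 := by
      rw [add_div, div_self (by positivity), abs_le]
      have : 0 ≤ b / x ^ 2 := by positivity
      constructor <;> linarith
    have e2 : x ^ 2 * Real.exp (-(x / 8)) ≤ 128 := by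
      have h := Real.quadratic_le_exp_of_nonneg (by positivity : 0 ≤ x / 8)
      have h' : x ^ 2 ≤ 128 * Real.exp (x / 8) := by nlinarith
      calc x ^ 2 * Real.exp (-(x / 8)) ≤ 128 * Real.exp (x / 8) * Real.exp (-(x / 8)) := by gcongr
        _ = 128 := by rw [mul_assoc, ← Real.exp_add]; simp
    have e3 : Real.exp (-(x / 8)) ≤ 1 := Real.exp_le_one_iff.2 (by linarith)
    have e4 : x ^ (κ - 2) = x ^ κ / x ^ 2 := by
      rw [Real.rpow_sub hx]; norm_num
    simp only [w2]
    rw [norm_mul, Complex.norm_real, Real.norm_eq_abs, e4]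
    calc |1 - b / x ^ 2| * ‖w x‖ ≤ (x ^ 2 + b) / x ^ 2 * (C * (x ^ κ * Real.exp (-(x / 8)))) := by
          gcongr
          exact hbw x hx
      _ = C * (x ^ 2 * Real.exp (-(x / 8)) + b * Real.exp (-(x / 8))) * (x ^ κ / x ^ 2) := by ring
      _ ≤ C * (128 + b * 1) * (x ^ κ / x ^ 2) := by gcongr
      _ ≤ C * (1 + b + 128) * (x ^ κ / x ^ 2) :=
          mul_le_mul_of_nonneg_right (mul_le_mul_of_nonneg_left (by linarith) hC0) (by positivity)

lemma gam_properties {β : ℝ} (hβ : 0 < β) (hβ4 : β ^ 2 ≠ 1 / 4) :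
    gam β ^ 2 = ((1 / 4 - β ^ 2 : ℝ) : ℂ) ∧ gam β ≠ 0 ∧ 0 ≤ (gam β).re ∧ (gam β).re < 1 / 2 := by
  have hsq : gam β ^ 2 = ((1 / 4 - β ^ 2 : ℝ) : ℂ) := by
    rw [gam, show (1 : ℂ) / 2 = ((2 : ℕ) : ℂ)⁻¹ by norm_num,
      Complex.cpow_nat_inv_pow _ two_ne_zero]
  have hne : gam β ≠ 0 := by
    intro h
    have h0 : ((1 / 4 - β ^ 2 : ℝ) : ℂ) = 0 := by rw [← hsq, h]; simp
    have := Complex.ofReal_eq_zero.1 h0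
    exact hβ4 (by linarith)
  have him := congrArg Complex.im hsq
  have hre := congrArg Complex.re hsq
  rw [sq, Complex.mul_im, Complex.ofReal_im] at him
  rw [sq, Complex.mul_re, Complex.ofReal_re] at hre
  have hprod : (gam β).re * (gam β).im = 0 := by linarith
  have hβ2 : 0 < β ^ 2 := by positivity
  refine ⟨hsq, hne, ?_, ?_⟩
  · rcases le_total 0 (1 / 4 - β ^ 2) with h | h
    · have : gam β = (((1 / 4 - β ^ 2) ^ (1 / 2 : ℝ) : ℝ) : ℂ) := by
        rw [gam, Complex.ofReal_cpow h]
        norm_num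
      rw [this, Complex.ofReal_re]
      positivity
    · rcases mul_eq_zero.1 hprod with h0 | h0
      · exact h0.ge
      · rw [h0] at hre
        have : (gam β).re = 0 := by nlinarith
        exact this.ge
  · rcases mul_eq_zero.1 hprod with h0 | h0
    · rw [h0]; norm_num
    · rw [h0] at hre
      nlinarith

/-- The one-sided correlation `y ↦ ∫_S k(η) g(y + εη) dη`. -/
def halfConv (S : Set ℝ) (k : ℝ → ℂ) (ε : ℝ) (g : ℝ → ℂ) (y : ℝ) : ℂ :=
  ∫ η in S, k η * g (y + ε * η)

lemma lintegral_sq_lintegral_comp_add_le (ν : Measure ℝ) [SFinite ν] (ε : ℝ) {g : ℝ → ℝ≥0∞}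
    (hg : Measurable g) :
    ∫⁻ y, (∫⁻ η, g (y + ε * η) ∂ν) ^ 2 ≤ (ν univ) ^ 2 * ∫⁻ y, g y ^ 2 := by
  have hcs : ∀ y, (∫⁻ η, g (y + ε * η) ∂ν) ^ 2 ≤ ν univ * ∫⁻ η, g (y + ε * η) ^ 2 ∂ν := by
    intro y
    have h := ENNReal.lintegral_mul_le_Lp_mul_Lq ν Real.HolderConjugate.two_two
      (f := fun _ => 1) (g := fun η => g (y + ε * η)) aemeasurable_const (by fun_prop)
    simp only [Pi.mul_apply, one_mul, ENNReal.one_rpow, lintegral_one] at h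
    calc (∫⁻ η, g (y + ε * η) ∂ν) ^ 2 ≤ _ := pow_le_pow_left₀ zero_le h 2
      _ = _ := by
        rw [mul_pow, ← ENNReal.rpow_natCast, ← ENNReal.rpow_natCast, ← ENNReal.rpow_mul,
          ← ENNReal.rpow_mul]
        norm_num
  calc ∫⁻ y, (∫⁻ η, g (y + ε * η) ∂ν) ^ 2
      ≤ ∫⁻ y, ν univ * ∫⁻ η, g (y + ε * η) ^ 2 ∂ν := lintegral_mono hcs
    _ = ν univ * ∫⁻ y, ∫⁻ η, g (y + ε * η) ^ 2 ∂ν := by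
        refine lintegral_const_mul _ (Measurable.lintegral_prod_right' (f := fun p : ℝ × ℝ =>
          g (p.1 + ε * p.2) ^ 2) (by fun_prop))
    _ = ν univ * ∫⁻ η, (∫⁻ y, g (y + ε * η) ^ 2) ∂ν := by
        rw [lintegral_lintegral_swap]
        exact Measurable.aemeasurable (by fun_prop)
    _ = ν univ * (∫⁻ _, (∫⁻ y, g y ^ 2) ∂ν) := by
        congr 1
        refine lintegral_congr fun η => ?_
        exact lintegral_add_right_eq_self (fun y => g y ^ 2) (ε * η)
    _ = _ := by rw [lintegral_const]; ring

lemma eLpNorm_two_sq (f : ℝ → ℂ) :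
    eLpNorm f 2 volume ^ 2 = ∫⁻ y, ‖f y‖ₑ ^ 2 := by
  have h := eLpNorm_nnreal_pow_eq_lintegral (μ := (volume : Measure ℝ)) (f := f)
    (p := 2) (by norm_num)
  rw [← ENNReal.rpow_natCast]
  simpa using h

/-- Young's inequality `L¹ × L² → L²` for one-sided correlations. -/
lemma eLpNorm_halfConv_le {S : Set ℝ} {k g : ℝ → ℂ} (hk : IntegrableOn k S) (hg : Continuous g)
    (ε : ℝ) :
    eLpNorm (halfConv S k ε g) 2 volume
      ≤ ENNReal.ofReal (∫ η in S, ‖k η‖) * eLpNorm g 2 volume := by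
  set ν := (volume.restrict S).withDensity fun η => ‖k η‖ₑ
  have hν : ν univ = ENNReal.ofReal (∫ η in S, ‖k η‖) := by
    rw [ofReal_integral_norm_eq_lintegral_enorm hk]
    simp [ν]
  have hpt : ∀ y, ‖halfConv S k ε g y‖ₑ ≤ ∫⁻ η, ‖g (y + ε * η)‖ₑ ∂ν := by
    intro y
    refine (enorm_integral_le_lintegral_enorm _).trans_eq ?_
    simp only [ν]
    rw [lintegral_withDensity_eq_lintegral_mul₀ hk.1.enorm
      (Continuous.aemeasurable (by fun_prop))]
    simp [enorm_mul]
  rw [← hν]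
  refine (ENNReal.pow_le_pow_left_iff two_ne_zero).1 ?_
  rw [mul_pow, eLpNorm_two_sq, eLpNorm_two_sq]
  refine (lintegral_mono fun y => pow_le_pow_left₀ zero_le (hpt y) 2).trans ?_
  exact lintegral_sq_lintegral_comp_add_le ν ε (g := fun y => ‖g y‖ₑ) hg.enorm.measurable

/-- Bounded continuously differentiable functions, with their derivative. -/
structure BddC1 (g g' : ℝ → ℂ) : Prop where
  hasDerivAt : ∀ s, HasDerivAt g (g' s) s
  continuous_deriv : Continuous g'
  bounded : ∃ M, ∀ s, ‖g s‖ ≤ M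
  bounded_deriv : ∃ M, ∀ s, ‖g' s‖ ≤ M

lemma BddC1.continuous {g g' : ℝ → ℂ} (h : BddC1 g g') : Continuous g :=
  continuous_iff_continuousAt.2 fun s => (h.hasDerivAt s).continuousAt

lemma ContDiff.bddC1_deriv {g : ℝ → ℂ} (hg : ContDiff ℝ (⊤ : ℕ∞) g) (hs : HasCompactSupport g) :
    BddC1 g (deriv g) where
  hasDerivAt s := (hg.differentiable (by simp) s).hasDerivAt
  continuous_deriv := hg.continuous_deriv (by simp)
  bounded := hg.continuous.bounded_above_of_compact_support hs
  bounded_deriv := (hg.continuous_deriv (by simp)).bounded_above_of_compact_support hs.deriv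

lemma BddC1.add {f f' g g' : ℝ → ℂ} (hf : BddC1 f f') (hg : BddC1 g g') :
    BddC1 (fun s => f s + g s) (fun s => f' s + g' s) where
  hasDerivAt s := (hf.hasDerivAt s).add (hg.hasDerivAt s)
  continuous_deriv := hf.continuous_deriv.add hg.continuous_deriv
  bounded := by
    obtain ⟨M, hM⟩ := hf.bounded
    obtain ⟨N, hN⟩ := hg.bounded
    exact ⟨M + N, fun s => (norm_add_le _ _).trans (add_le_add (hM s) (hN s))⟩
  bounded_deriv := by
    obtain ⟨M, hM⟩ := hf.bounded_deriv
    obtain ⟨N, hN⟩ := hg.bounded_deriv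
    exact ⟨M + N, fun s => (norm_add_le _ _).trans (add_le_add (hM s) (hN s))⟩

lemma BddC1.const_mul {f f' : ℝ → ℂ} (hf : BddC1 f f') (c : ℂ) :
    BddC1 (fun s => c * f s) (fun s => c * f' s) where
  hasDerivAt s := (hf.hasDerivAt s).const_mul c
  continuous_deriv := continuous_const.mul hf.continuous_deriv
  bounded := by
    obtain ⟨M, hM⟩ := hf.bounded
    exact ⟨‖c‖ * M, fun s => by rw [norm_mul]; gcongr; exact hM s⟩
  bounded_deriv := by
    obtain ⟨M, hM⟩ := hf.bounded_deriv
    exact ⟨‖c‖ * M, fun s => by rw [norm_mul]; gcongr; exact hM s⟩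

lemma norm_exp_neg_I_mul (T s : ℝ) : ‖Complex.exp (-(Complex.I * T * s))‖ = 1 := by
  rw [show -(Complex.I * T * s) = ((-(T * s) : ℝ) : ℂ) * Complex.I by push_cast; ring]
  exact Complex.norm_exp_ofReal_mul_I _

lemma BddC1.exp_mul {f f' : ℝ → ℂ} (hf : BddC1 f f') (T : ℝ) :
    BddC1 (fun s => Complex.exp (-(Complex.I * T * s)) * f s)
      (fun s => Complex.exp (-(Complex.I * T * s)) * f' s
        - Complex.I * T * (Complex.exp (-(Complex.I * T * s)) * f s)) where
  hasDerivAt s := by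
    have h : HasDerivAt (fun s : ℝ => Complex.exp (-(Complex.I * T * s)))
        (Complex.exp (-(Complex.I * T * s)) * (-(Complex.I * T * 1))) s :=
      ((hasDerivAt_id s).ofReal_comp.const_mul (Complex.I * T)).neg.cexp
    exact (h.mul (hf.hasDerivAt s)).congr_deriv (by ring)
  continuous_deriv := by
    have := hf.continuous
    have := hf.continuous_deriv
    fun_prop
  bounded := by
    obtain ⟨M, hM⟩ := hf.bounded
    exact ⟨M, fun s => by rw [norm_mul, norm_exp_neg_I_mul, one_mul]; exact hM s⟩
  bounded_deriv := by
    obtain ⟨M, hM⟩ := hf.bounded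
    obtain ⟨N, hN⟩ := hf.bounded_deriv
    refine ⟨N + ‖Complex.I * T‖ * M, fun s => (norm_sub_le _ _).trans (add_le_add ?_ ?_)⟩
    · rw [norm_mul, norm_exp_neg_I_mul, one_mul]; exact hN s
    · rw [norm_mul, norm_mul (Complex.exp _), norm_exp_neg_I_mul, one_mul]
      gcongr
      exact hM s

lemma integrableOn_mul_comp_add {S : Set ℝ} {k g : ℝ → ℂ} (hk : IntegrableOn k S)
    (hg : Continuous g) (hb : ∃ M, ∀ s, ‖g s‖ ≤ M) (ε y : ℝ) :
    IntegrableOn (fun η => k η * g (y + ε * η)) S := by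
  obtain ⟨M, hM⟩ := hb
  refine Integrable.mul_bdd (c := M) hk ?_ (ae_of_all _ fun η => hM _)
  exact Continuous.aestronglyMeasurable (by fun_prop)

lemma continuous_halfConv {S : Set ℝ} {k g : ℝ → ℂ} (hk : IntegrableOn k S)
    (hg : Continuous g) (hb : ∃ M, ∀ s, ‖g s‖ ≤ M) (ε : ℝ) : Continuous (halfConv S k ε g) := by
  obtain ⟨M, hM⟩ := hb
  refine continuous_of_dominated (bound := fun η => ‖k η‖ * M)
    (fun y => (integrableOn_mul_comp_add hk hg ⟨M, hM⟩ ε y).1)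
    (fun y => ae_of_all _ fun η => ?_) (hk.norm.mul_const M) (ae_of_all _ fun η => by fun_prop)
  rw [norm_mul]
  gcongr
  exact hM _

lemma norm_halfConv_le {S : Set ℝ} {k g : ℝ → ℂ} (hk : IntegrableOn k S)
    {M : ℝ} (hM : ∀ s, ‖g s‖ ≤ M) (ε y : ℝ) :
    ‖halfConv S k ε g y‖ ≤ ∫ η in S, ‖k η‖ * M := by
  refine norm_integral_le_of_norm_le (hk.norm.mul_const M) (ae_of_all _ fun η => ?_)
  rw [norm_mul]
  gcongr
  exact hM _

lemma BddC1.halfConv {S : Set ℝ} {k g g' : ℝ → ℂ} (hk : IntegrableOn k S) (hg : BddC1 g g')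
    (ε : ℝ) : BddC1 (halfConv S k ε g) (halfConv S k ε g') where
  hasDerivAt y := by
    obtain ⟨M, hM⟩ := hg.bounded_deriv
    refine (hasDerivAt_integral_of_dominated_loc_of_deriv_le (s := univ) (x₀ := y)
      (bound := fun η => ‖k η‖ * M) (F := fun y η => k η * g (y + ε * η))
      (F' := fun y η => k η * g' (y + ε * η)) univ_mem
      (Eventually.of_forall fun y =>
        (integrableOn_mul_comp_add hk hg.continuous hg.bounded ε y).1)
      (integrableOn_mul_comp_add hk hg.continuous hg.bounded ε y)
      (integrableOn_mul_comp_add hk hg.continuous_deriv hg.bounded_deriv ε y).1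
      (ae_of_all _ fun η y _ => ?_) (hk.norm.mul_const M) (ae_of_all _ fun η y _ => ?_)).2
    · rw [norm_mul]
      gcongr
      exact hM _
    · exact ((hg.hasDerivAt (y + ε * η)).comp_add_const y (ε * η)).const_mul (k η)
  continuous_deriv := continuous_halfConv hk hg.continuous_deriv hg.bounded_deriv ε
  bounded := by
    obtain ⟨M, hM⟩ := hg.bounded
    exact ⟨_, norm_halfConv_le hk hM ε⟩
  bounded_deriv := by
    obtain ⟨M, hM⟩ := hg.bounded_deriv
    exact ⟨_, norm_halfConv_le hk hM ε⟩

lemma halfConv_deriv_eq {k k1 h h' : ℝ → ℂ} {a ε : ℝ} {ka : ℂ} (hε : ε * ε = 1)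
    (hk : IntegrableOn k (Ioi a)) (hk1 : IntegrableOn k1 (Ioi a))
    (hd : ∀ η > a, HasDerivAt k (k1 η) η) (ha : Tendsto k (𝓝[>] a) (𝓝 ka))
    (htop : Tendsto k atTop (𝓝 0)) (hh : BddC1 h h') (y : ℝ) :
    halfConv (Ioi a) k ε h' y
      = -(ε * (ka * h (y + ε * a))) - ε * halfConv (Ioi a) k1 ε h y := by
  have hv : ∀ η, HasDerivAt (fun η => (ε : ℂ) * h (y + ε * η)) (h' (y + ε * η)) η := by
    intro η
    have h1 : HasDerivAt (fun η => y + ε * η) ε η := by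
      simpa using ((hasDerivAt_id η).const_mul ε).const_add y
    have h2 := ((hh.hasDerivAt (y + ε * η)).scomp η h1).const_mul (ε : ℂ)
    refine h2.congr_deriv ?_
    rw [Complex.real_smul, ← mul_assoc, ← Complex.ofReal_mul, hε]
    simp
  have hc : Continuous fun η => (ε : ℂ) * h (y + ε * η) := by
    have := hh.continuous
    fun_prop
  obtain ⟨M, hM⟩ := hh.bounded
  have key := integral_Ioi_mul_deriv_eq_deriv_mul (a := a) (u := k)
    (v := fun η => (ε : ℂ) * h (y + ε * η)) (u' := k1) (v' := fun η => h' (y + ε * η))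
    (a' := ka * (ε * h (y + ε * a))) (b' := 0) (fun η hη => hd η hη) (fun η _ => hv η)
    (integrableOn_mul_comp_add hk hh.continuous_deriv hh.bounded_deriv ε y) ?_ ?_ ?_
  · rw [halfConv, key, halfConv, ← integral_const_mul]
    simp only [mul_left_comm _ (ε : ℂ)]
    ring
  · have h3 := (integrableOn_mul_comp_add hk1 hh.continuous ⟨M, hM⟩ ε y).const_mul (ε : ℂ)
    refine h3.congr (ae_of_all _ fun η => ?_)
    simp only [Pi.mul_apply]
    ring
  · exact ha.mul (hc.tendsto a |>.mono_left nhdsWithin_le_nhds)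
  · refine squeeze_zero_norm (a := fun η => ‖k η‖ * (‖(ε : ℂ)‖ * M)) (fun η => ?_) ?_
    · simp only [Pi.mul_apply]
      rw [norm_mul, norm_mul]
      gcongr
      exact hM _
    · simpa using htop.norm.mul_const (‖(ε : ℂ)‖ * M)

lemma eLpNorm_comp_add_const {h : ℝ → ℂ} (hh : Continuous h) (c : ℝ) :
    eLpNorm (fun y => h (y + c)) 2 volume = eLpNorm h 2 volume :=
  eLpNorm_comp_measurePreserving hh.aestronglyMeasurable (measurePreserving_add_right volume c)

lemma eLpNorm_exp_neg_I_mul (T : ℝ) (f : ℝ → ℂ) :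
    eLpNorm (fun s : ℝ => Complex.exp (-(Complex.I * T * s)) * f s) 2 volume
      = eLpNorm f 2 volume :=
  eLpNorm_congr_norm_ae (ae_of_all _ fun s => by rw [norm_mul, norm_exp_neg_I_mul, one_mul])

lemma eLpNorm_const_mul_eq (c : ℂ) (f : ℝ → ℂ) :
    eLpNorm (fun s : ℝ => c * f s) 2 volume = ENNReal.ofReal ‖c‖ * eLpNorm f 2 volume := by
  rw [ofReal_norm]
  exact eLpNorm_const_smul c f 2 volume

lemma halfConv_union {k g : ℝ → ℂ} {δ : ℝ} (hδ : 0 ≤ δ) (hk : IntegrableOn k (Ioi 0))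
    (hg : Continuous g) (hb : ∃ M, ∀ s, ‖g s‖ ≤ M) (ε y : ℝ) :
    halfConv (Ioi 0) k ε g y = halfConv (Ioc 0 δ) k ε g y + halfConv (Ioi δ) k ε g y := by
  have h := integrableOn_mul_comp_add hk hg hb ε y
  rw [halfConv, ← Ioc_union_Ioi_eq_Ioi hδ, setIntegral_union
    (Ioc_disjoint_Ioi le_rfl) measurableSet_Ioi (h.mono_set Ioc_subset_Ioi_self)
    (h.mono_set (Ioi_subset_Ioi hδ)), halfConv, halfConv]

/-- Oscillation estimate: correlating a kernel with a function carrying the phase `e^{-iTs}`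
gains `T⁻¹` away from the singularity of the kernel, at the cost of one derivative. -/
lemma eLpNorm_halfConv_oscillatory_le {k k1 f f' : ℝ → ℂ} {T δ ε : ℝ} (hT : 0 < T) (hδ : 0 < δ)
    (hε : ε * ε = 1) (hk : IntegrableOn k (Ioi 0)) (hk1 : IntegrableOn k1 (Ioi δ))
    (hd : ∀ η > 0, HasDerivAt k (k1 η) η) (htop : Tendsto k atTop (𝓝 0)) (hf : BddC1 f f') :
    eLpNorm (halfConv (Ioi 0) k ε fun s => Complex.exp (-(Complex.I * T * s)) * f s) 2 volume
      ≤ ENNReal.ofReal (∫ η in Ioc 0 δ, ‖k η‖) * eLpNorm f 2 volume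
        + ENNReal.ofReal T⁻¹ * (ENNReal.ofReal (∫ η in Ioi δ, ‖k η‖) * eLpNorm f' 2 volume
          + (ENNReal.ofReal ‖k δ‖ * eLpNorm f 2 volume
          + ENNReal.ofReal (∫ η in Ioi δ, ‖k1 η‖) * eLpNorm f 2 volume)) := by
  set h : ℝ → ℂ := fun s => Complex.exp (-(Complex.I * T * s)) * f s
  set h1 : ℝ → ℂ := fun s => Complex.exp (-(Complex.I * T * s)) * f' s
  have hε1 : |ε| = 1 := by
    rcases mul_self_eq_one_iff.1 hε with h | h <;> simp [h]
  have hh := hf.exp_mul T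
  have hkδ : IntegrableOn k (Ioi δ) := hk.mono_set (Ioi_subset_Ioi hδ.le)
  have hk0 : IntegrableOn k (Ioc 0 δ) := hk.mono_set Ioc_subset_Ioi_self
  have hh1c : Continuous h1 := by
    have := hf.continuous_deriv
    fun_prop
  have hh1b : ∃ M, ∀ s, ‖h1 s‖ ≤ M := by
    obtain ⟨M, hM⟩ := hf.bounded_deriv
    exact ⟨M, fun s => by simp only [h1]; rw [norm_mul, norm_exp_neg_I_mul, one_mul]; exact hM s⟩
  have hTc : Complex.I * (T : ℂ) ≠ 0 :=
    mul_ne_zero Complex.I_ne_zero (Complex.ofReal_ne_zero.2 hT.ne')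
  have hfar : ∀ y, halfConv (Ioi δ) k ε h y = (Complex.I * T)⁻¹ *
      (halfConv (Ioi δ) k ε h1 y + ((ε * k δ) * h (y + ε * δ)
        + ε * halfConv (Ioi δ) k1 ε h y)) := by
    intro y
    have hibp := halfConv_deriv_eq hε hkδ hk1 (fun η hη => hd η (hδ.trans hη))
      ((hd δ hδ).continuousAt.tendsto.mono_left nhdsWithin_le_nhds) htop hh y
    have hsplit : halfConv (Ioi δ) k ε (fun s => h1 s - Complex.I * T * h s) y
        = halfConv (Ioi δ) k ε h1 y - Complex.I * T * halfConv (Ioi δ) k ε h y := by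
      simp only [halfConv]
      rw [← integral_const_mul, ← integral_sub (integrableOn_mul_comp_add hkδ hh1c hh1b ε y)
        ((integrableOn_mul_comp_add hkδ hh.continuous hh.bounded ε y).const_mul _)]
      congr 1
      ext η
      ring
    have e : halfConv (Ioi δ) k ε h1 y - Complex.I * T * halfConv (Ioi δ) k ε h y = _ :=
      hsplit.symm.trans hibp
    rw [eq_inv_mul_iff_mul_eq₀ hTc]
    linear_combination -e
  have hfun : halfConv (Ioi 0) k ε h = (halfConv (Ioc 0 δ) k ε h) + fun y =>
      (Complex.I * T)⁻¹ * ((halfConv (Ioi δ) k ε h1) + ((fun y => (ε * k δ) * h (y + ε * δ))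
        + fun y => ε * halfConv (Ioi δ) k1 ε h y)) y := by
    ext y
    rw [halfConv_union hδ.le hk hh.continuous hh.bounded, hfar]
    rfl
  have c0 := continuous_halfConv hk0 hh.continuous hh.bounded ε
  have c1 := continuous_halfConv hkδ hh1c hh1b ε
  have c2 := continuous_halfConv hk1 hh.continuous hh.bounded ε
  have c3 : Continuous h := hh.continuous
  have nT : ‖(Complex.I * (T : ℂ))⁻¹‖ = T⁻¹ := by
    rw [norm_inv, norm_mul, Complex.norm_I, one_mul, Complex.norm_real, Real.norm_of_nonneg hT.le]
  have nε : ‖(ε : ℂ)‖ = 1 := by rw [Complex.norm_real, Real.norm_eq_abs, hε1]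
  have nh : eLpNorm h 2 volume = eLpNorm f 2 volume := eLpNorm_exp_neg_I_mul T f
  have nh1 : eLpNorm h1 2 volume = eLpNorm f' 2 volume := eLpNorm_exp_neg_I_mul T f'
  rw [hfun, ← nh, ← nh1]
  refine (eLpNorm_add_le c0.aestronglyMeasurable
    (Continuous.aestronglyMeasurable (by simp only [Pi.add_apply]; fun_prop))
    (by norm_num)).trans ?_
  refine add_le_add (eLpNorm_halfConv_le hk0 c3 ε) ?_
  rw [eLpNorm_const_mul_eq, nT]
  refine mul_le_mul_right ?_ _
  refine (eLpNorm_add_le c1.aestronglyMeasurable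
    (Continuous.aestronglyMeasurable (by fun_prop)) (by norm_num)).trans ?_
  refine add_le_add (eLpNorm_halfConv_le hkδ hh1c ε) ?_
  refine (eLpNorm_add_le (Continuous.aestronglyMeasurable (by fun_prop))
    (Continuous.aestronglyMeasurable (by fun_prop)) (by norm_num)).trans ?_
  refine add_le_add ?_ ?_
  · rw [eLpNorm_const_mul_eq, eLpNorm_comp_add_const c3, norm_mul, nε, one_mul]
  · rw [eLpNorm_const_mul_eq, nε, ENNReal.ofReal_one, one_mul]
    exact eLpNorm_halfConv_le hk1 c3 ε

/-- The quantitative properties of `w(x) = W_{0,γ}(2x)` and its first two derivatives used in the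
decay estimate. -/
structure DecayProfile (κ D : ℝ) (w w1 w2 : ℝ → ℂ) : Prop where
  hasDerivAt : ∀ x > 0, HasDerivAt w (w1 x) x
  hasDerivAt_deriv : ∀ x > 0, HasDerivAt w1 (w2 x) x
  integrableOn : IntegrableOn w (Ioi 0)
  integrableOn_mul : IntegrableOn (fun x : ℝ => (x : ℂ) * w x) (Ioi 0)
  integrableOn_deriv : IntegrableOn w1 (Ioi 0)
  integrableOn_deriv2 : ∀ s > 0, IntegrableOn w2 (Ioi s)
  tendsto_zero : Tendsto w (𝓝[>] 0) (𝓝 0)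
  tendsto_atTop : Tendsto w atTop (𝓝 0)
  tendsto_deriv_atTop : Tendsto w1 atTop (𝓝 0)
  integral_norm_deriv_le : ∀ s > 0, ∫ x in Ioc 0 s, ‖w1 x‖ ≤ D * s ^ κ
  norm_deriv_le : ∀ s > 0, ‖w1 s‖ ≤ D * s ^ (κ - 1)
  integral_norm_deriv2_le : ∀ s > 0, ∫ x in Ioi s, ‖w2 x‖ ≤ D * s ^ (κ - 1)

lemma integrableOn_rpow_mul_exp_neg_div {s : ℝ} (hs : -1 < s) :
    IntegrableOn (fun x : ℝ => x ^ s * Real.exp (-(x / 8))) (Ioi 0) := by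
  have h := integrableOn_rpow_mul_exp_neg_mul_rpow hs one_pos (by norm_num : (0 : ℝ) < 1 / 8)
  refine h.congr_fun (fun x _ => ?_) measurableSet_Ioi
  simp only [Real.rpow_one]
  congr 2
  ring

lemma tendsto_rpow_mul_exp_neg_div (s : ℝ) :
    Tendsto (fun x : ℝ => x ^ s * Real.exp (-(x / 8))) atTop (𝓝 0) := by
  have h := tendsto_rpow_mul_exp_neg_mul_atTop_nhds_zero s (1 / 8) (by norm_num)
  refine h.congr fun x => ?_
  congr 2
  ring

lemma exists_decayProfile {κ K : ℝ} {w w1 w2 : ℝ → ℂ} (hκ0 : 0 < κ) (hκ1 : κ < 1) (hK : 0 ≤ K)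
    (hw : ∀ x > 0, HasDerivAt w (w1 x) x) (hw1 : ∀ x > 0, HasDerivAt w1 (w2 x) x)
    (hw2 : ContinuousOn w2 (Ioi 0))
    (b : ∀ x > 0, ‖w x‖ ≤ K * (x ^ κ * Real.exp (-(x / 8))))
    (b1 : ∀ x > 0, ‖w1 x‖ ≤ K * (x ^ (κ - 1) * Real.exp (-(x / 8))))
    (b2 : ∀ x > 0, ‖w2 x‖ ≤ K * x ^ (κ - 2)) :
    ∃ D, 0 ≤ D ∧ DecayProfile κ D w w1 w2 := by
  have h1κ : 0 < 1 - κ := by linarith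
  have cw : ContinuousOn w (Ioi 0) := fun x hx => (hw x hx).continuousAt.continuousWithinAt
  have cw1 : ContinuousOn w1 (Ioi 0) := fun x hx => (hw1 x hx).continuousAt.continuousWithinAt
  have i1 : IntegrableOn w1 (Ioi 0) := by
    refine Integrable.mono' ((integrableOn_rpow_mul_exp_neg_div (s := κ - 1)
      (by linarith)).const_mul K) (cw1.aestronglyMeasurable measurableSet_Ioi) ?_
    exact (ae_restrict_iff' measurableSet_Ioi).2 (ae_of_all _ fun x hx => b1 x hx)
  have b1' : ∀ x > 0, ‖w1 x‖ ≤ K * x ^ (κ - 1) := fun x hx => by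
    refine (b1 x hx).trans (mul_le_mul_of_nonneg_left ?_ hK)
    exact mul_le_of_le_one_right (by positivity) (Real.exp_le_one_iff.2 (by linarith))
  have i2 : ∀ s > 0, IntegrableOn w2 (Ioi s) := fun s hs => by
    refine Integrable.mono' ((integrableOn_Ioi_rpow_of_lt (a := κ - 2)
      (by linarith) hs).const_mul K)
      ((hw2.mono (Ioi_subset_Ioi hs.le)).aestronglyMeasurable measurableSet_Ioi) ?_
    exact (ae_restrict_iff' measurableSet_Ioi).2 (ae_of_all _ fun x hx => b2 x (hs.trans hx))
  have hd1 : 0 ≤ K / κ := by positivity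
  have hd2 : 0 ≤ K / (1 - κ) := by positivity
  refine ⟨K / κ + K + K / (1 - κ), by positivity, hw, hw1, ?_, ?_, i1, i2, ?_, ?_, ?_, ?_, ?_, ?_⟩
  · refine Integrable.mono' ((integrableOn_rpow_mul_exp_neg_div (s := κ)
      (by linarith)).const_mul K) (cw.aestronglyMeasurable measurableSet_Ioi) ?_
    exact (ae_restrict_iff' measurableSet_Ioi).2 (ae_of_all _ fun x hx => b x hx)
  · refine Integrable.mono' ((integrableOn_rpow_mul_exp_neg_div (s := κ + 1)
      (by linarith)).const_mul K) ((Complex.continuous_ofReal.continuousOn.mul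
        cw).aestronglyMeasurable measurableSet_Ioi) ?_
    refine (ae_restrict_iff' measurableSet_Ioi).2 (ae_of_all _ fun x hx => ?_)
    rw [mem_Ioi] at hx
    rw [norm_mul, Complex.norm_real, Real.norm_of_nonneg hx.le, Real.rpow_add_one hx.ne']
    calc x * ‖w x‖ ≤ x * (K * (x ^ κ * Real.exp (-(x / 8)))) :=
          mul_le_mul_of_nonneg_left (b x hx) hx.le
      _ = _ := by ring
  · refine squeeze_zero_norm' (a := fun x => K * x ^ κ) ?_ ?_
    · filter_upwards [self_mem_nhdsWithin] with x hx
      rw [mem_Ioi] at hx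
      refine (b x hx).trans (mul_le_mul_of_nonneg_left ?_ hK)
      exact mul_le_of_le_one_right (by positivity) (Real.exp_le_one_iff.2 (by linarith))
    · have := ((Real.continuousAt_rpow_const 0 κ (Or.inr hκ0.le)).const_mul K).tendsto
      simp only [Real.zero_rpow hκ0.ne', mul_zero] at this
      exact this.mono_left nhdsWithin_le_nhds
  · refine squeeze_zero_norm' ((eventually_gt_atTop 0).mono b) ?_
    simpa using (tendsto_rpow_mul_exp_neg_div κ).const_mul K
  · refine squeeze_zero_norm' ((eventually_gt_atTop 0).mono b1) ?_
    simpa using (tendsto_rpow_mul_exp_neg_div (κ - 1)).const_mul K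
  · intro s hs
    have hi : IntegrableOn (fun x : ℝ => K * x ^ (κ - 1)) (Ioc 0 s) := by
      rw [← intervalIntegrable_iff_integrableOn_Ioc_of_le hs.le]
      exact (intervalIntegral.intervalIntegrable_rpow' (by linarith)).const_mul K
    calc ∫ x in Ioc 0 s, ‖w1 x‖ ≤ ∫ x in Ioc 0 s, K * x ^ (κ - 1) :=
          setIntegral_mono_on (i1.mono_set Ioc_subset_Ioi_self).norm hi measurableSet_Ioc
            fun x hx => b1' x hx.1
      _ = K / κ * s ^ κ := by
          rw [← intervalIntegral.integral_of_le hs.le, intervalIntegral.integral_const_mul,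
            integral_rpow (Or.inl (by linarith)), sub_add_cancel, Real.zero_rpow hκ0.ne']
          ring
      _ ≤ _ := mul_le_mul_of_nonneg_right (by linarith) (by positivity)
  · intro s hs
    exact (b1' s hs).trans (mul_le_mul_of_nonneg_right (by linarith) (by positivity))
  · intro s hs
    calc ∫ x in Ioi s, ‖w2 x‖ ≤ ∫ x in Ioi s, K * x ^ (κ - 2) :=
          setIntegral_mono_on (i2 s hs).norm
            ((integrableOn_Ioi_rpow_of_lt (by linarith) hs).const_mul K) measurableSet_Ioi
            fun x hx => b2 x (hs.trans hx)
      _ = K / (1 - κ) * s ^ (κ - 1) := by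
          rw [integral_const_mul, integral_Ioi_rpow_of_lt (by linarith) hs,
            show κ - 2 + 1 = κ - 1 by ring, show κ - 1 = -(1 - κ) by ring, neg_div_neg_eq]
          ring
      _ ≤ _ := mul_le_mul_of_nonneg_right (by linarith) (by positivity)

section Scaling

variable {κ D M : ℝ} {w w1 w2 : ℝ → ℂ}

lemma HasDerivAt.comp_const_mul_ofReal {f f' : ℝ → ℂ} (hM : 0 < M)
    (hf : ∀ x > 0, HasDerivAt f (f' x) x) {η : ℝ} (hη : 0 < η) :
    HasDerivAt (fun η => f (M * η)) (M * f' (M * η)) η := by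
  have h1 : HasDerivAt (fun η => M * η) M η := by simpa using (hasDerivAt_id η).const_mul M
  have h2 := (hf (M * η) (by positivity)).scomp η h1
  rwa [Complex.real_smul] at h2

lemma integrableOn_Ioi_comp_const_mul {f : ℝ → ℂ} (hM : 0 < M) {a : ℝ}
    (hf : IntegrableOn f (Ioi (M * a))) : IntegrableOn (fun η => f (M * η)) (Ioi a) :=
  (integrableOn_Ioi_comp_mul_left_iff f a hM).2 hf

lemma integral_Ioi_norm_comp_const_mul (f : ℝ → ℂ) (hM : 0 < M) (a : ℝ) :
    ∫ η in Ioi a, ‖f (M * η)‖ = M⁻¹ * ∫ x in Ioi (M * a), ‖f x‖ := by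
  rw [integral_comp_mul_left_Ioi (fun x => ‖f x‖) a hM, smul_eq_mul]

lemma tendsto_atTop_comp_const_mul {f : ℝ → ℂ} (hM : 0 < M) (hf : Tendsto f atTop (𝓝 0)) :
    Tendsto (fun η => f (M * η)) atTop (𝓝 0) :=
  hf.comp (tendsto_id.const_mul_atTop hM)

/-- Decay in time of the kernel `M w1(M·)` correlated with an oscillating function. -/
lemma DecayProfile.eLpNorm_halfConv_le (P : DecayProfile κ D w w1 w2) (hκ : κ ≤ 1)
    (hM : 0 < M) {t ε : ℝ} (ht : 1 ≤ t) (hM1 : 1 ≤ M)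
    (hε : ε * ε = 1) {f f' : ℝ → ℂ} (hf : BddC1 f f') {X : ℝ≥0∞} (hX : eLpNorm f 2 volume ≤ X)
    (hX' : eLpNorm f' 2 volume ≤ X) :
    eLpNorm (halfConv (Ioi 0) (fun η => M * w1 (M * η)) ε
        fun s => Complex.exp (-(Complex.I * ((M * t : ℝ) : ℂ) * s)) * f s) 2 volume
      ≤ ENNReal.ofReal ((3 * D + ∫ x in Ioi 0, ‖w1 x‖) * t ^ (-κ)) * X := by
  have ht0 : 0 < t := by linarith
  have hT : 0 < M * t := by positivity
  have hδ : 0 < (M * t)⁻¹ := by positivity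
  have hMδ : M * (M * t)⁻¹ = t⁻¹ := by field_simp
  have hk : IntegrableOn (fun η => (M : ℂ) * w1 (M * η)) (Ioi 0) :=
    (integrableOn_Ioi_comp_const_mul hM (by simpa using P.integrableOn_deriv)).const_mul _
  have hk1 : IntegrableOn (fun η => (M : ℂ) * (M * w2 (M * η))) (Ioi (M * t)⁻¹) :=
    ((integrableOn_Ioi_comp_const_mul hM
      (P.integrableOn_deriv2 _ (by positivity))).const_mul _).const_mul _
  have nM : ‖(M : ℂ)‖ = M := by rw [Complex.norm_real, Real.norm_of_nonneg hM.le]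
  have hJ : 0 ≤ ∫ x in Ioi 0, ‖w1 x‖ := integral_nonneg fun _ => norm_nonneg _
  have I1 : ∫ η in Ioc 0 (M * t)⁻¹, ‖(M : ℂ) * w1 (M * η)‖ ≤ D * t ^ (-κ) := by
    simp only [norm_mul, nM]
    rw [integral_const_mul, ← intervalIntegral.integral_of_le hδ.le,
      intervalIntegral.integral_comp_mul_left (fun x => ‖w1 x‖) hM.ne', mul_zero, hMδ,
      intervalIntegral.integral_of_le (by positivity), smul_eq_mul, mul_inv_cancel_left₀ hM.ne',
      Real.rpow_neg ht0.le, ← Real.inv_rpow ht0.le]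
    exact P.integral_norm_deriv_le _ (by positivity)
  have I2 : ∫ η in Ioi (M * t)⁻¹, ‖(M : ℂ) * w1 (M * η)‖ ≤ ∫ x in Ioi 0, ‖w1 x‖ := by
    simp only [norm_mul, nM]
    rw [integral_const_mul, integral_Ioi_norm_comp_const_mul _ hM, mul_inv_cancel_left₀ hM.ne']
    exact setIntegral_mono_set P.integrableOn_deriv.norm (ae_of_all _ fun _ => norm_nonneg _)
      (Ioi_subset_Ioi (by positivity)).eventuallyLE
  have hpow : t⁻¹ ^ (κ - 1) = t * t ^ (-κ) := by
    rw [Real.inv_rpow ht0.le, ← Real.rpow_neg ht0.le, neg_sub, sub_eq_add_neg,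
      Real.rpow_add ht0, Real.rpow_one]
  have I3 : ‖(M : ℂ) * w1 (M * (M * t)⁻¹)‖ ≤ M * t * (D * t ^ (-κ)) := by
    rw [norm_mul, nM, hMδ]
    calc M * ‖w1 t⁻¹‖ ≤ M * (D * t⁻¹ ^ (κ - 1)) :=
          mul_le_mul_of_nonneg_left (P.norm_deriv_le _ (by positivity)) hM.le
      _ = _ := by rw [hpow]; ring
  have I4 : ∫ η in Ioi (M * t)⁻¹, ‖(M : ℂ) * (M * w2 (M * η))‖ ≤ M * t * (D * t ^ (-κ)) := by
    simp only [norm_mul, nM]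
    rw [integral_const_mul, integral_const_mul, integral_Ioi_norm_comp_const_mul _ hM,
      mul_inv_cancel_left₀ hM.ne', hMδ]
    calc M * ∫ x in Ioi t⁻¹, ‖w2 x‖ ≤ M * (D * t⁻¹ ^ (κ - 1)) :=
          mul_le_mul_of_nonneg_left (P.integral_norm_deriv2_le _ (by positivity)) hM.le
      _ = _ := by rw [hpow]; ring
  have hinv : (M * t)⁻¹ ≤ t ^ (-κ) := by
    calc (M * t)⁻¹ ≤ t⁻¹ := inv_anti₀ ht0 (le_mul_of_one_le_left ht0.le hM1)
      _ = t ^ (-1 : ℝ) := (Real.rpow_neg_one t).symm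
      _ ≤ _ := Real.rpow_le_rpow_of_exponent_le ht (by linarith)
  refine (eLpNorm_halfConv_oscillatory_le hT hδ hε hk hk1 (fun η hη => ?_)
    ?_ hf).trans ?_
  · exact (HasDerivAt.comp_const_mul_ofReal hM P.hasDerivAt_deriv hη).const_mul _
  · simpa using (tendsto_atTop_comp_const_mul hM P.tendsto_deriv_atTop).const_mul (M : ℂ)
  set R : ℝ := t ^ (-κ)
  have hR : 0 ≤ R := by positivity
  have hD : 0 ≤ D := by
    have := (norm_nonneg _).trans (P.norm_deriv_le 1 one_pos)
    simpa using this
  calc _ ≤ ENNReal.ofReal (D * R) * X + ENNReal.ofReal (M * t)⁻¹ *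
        (ENNReal.ofReal (∫ x in Ioi 0, ‖w1 x‖) * X + (ENNReal.ofReal (M * t * (D * R)) * X
          + ENNReal.ofReal (M * t * (D * R)) * X)) := by gcongr
    _ = ENNReal.ofReal (D * R + (M * t)⁻¹ * ((∫ x in Ioi 0, ‖w1 x‖) +
          (M * t * (D * R) + M * t * (D * R)))) * X := by
        rw [ENNReal.ofReal_add (by positivity) (by positivity),
          ENNReal.ofReal_mul (by positivity : 0 ≤ (M * t)⁻¹),
          ENNReal.ofReal_add hJ (by positivity), ENNReal.ofReal_add (by positivity) (by positivity)]
        ring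
    _ ≤ _ := by
        refine mul_le_mul_left (ENNReal.ofReal_le_ofReal ?_) X
        have e : (M * t)⁻¹ * ((∫ x in Ioi 0, ‖w1 x‖) + (M * t * (D * R) + M * t * (D * R)))
            = (M * t)⁻¹ * (∫ x in Ioi 0, ‖w1 x‖) + 2 * (D * R) := by
          field_simp
          ring
        rw [e]
        have := mul_le_mul_of_nonneg_right hinv hJ
        linarith

end Scaling

/-- The operator `∂_y² - m²`. -/
def modeLap (m : ℕ) (f : ℝ → ℂ) (s : ℝ) : ℂ := deriv (deriv f) s - (m : ℂ) ^ 2 * f s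

lemma ContDiff.deriv_infty {f : ℝ → ℂ} (hf : ContDiff ℝ (⊤ : ℕ∞) f) :
    ContDiff ℝ (⊤ : ℕ∞) (deriv f) :=
  (contDiff_infty_iff_deriv.1 hf).2

lemma ContDiff.bddC1_modeLap {f : ℝ → ℂ} (hf : ContDiff ℝ (⊤ : ℕ∞) f) (hs : HasCompactSupport f)
    (m : ℕ) : BddC1 (modeLap m f) (modeLap m (deriv f)) := by
  have h1 := hf.deriv_infty.deriv_infty.bddC1_deriv hs.deriv.deriv
  have h2 := (hf.bddC1_deriv hs).const_mul (-(m : ℂ) ^ 2)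
  have h := h1.add h2
  simp only [neg_mul, ← sub_eq_add_neg] at h
  exact h

lemma eLpNorm_modeLap_le {f : ℝ → ℂ} (hf : ContDiff ℝ (⊤ : ℕ∞) f) {m : ℕ} (hm : 1 ≤ m) :
    eLpNorm (modeLap m f) 2 volume ≤ ENNReal.ofReal ((m : ℝ) ^ 2) *
      (eLpNorm (deriv (deriv f)) 2 volume + eLpNorm f 2 volume) := by
  have hm1 : (1 : ℝ) ≤ m := by exact_mod_cast hm
  have h1 := (eLpNorm_sub_le (p := 2) hf.deriv_infty.deriv_infty.continuous.aestronglyMeasurable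
    (continuous_const.mul hf.continuous : Continuous fun s =>
      (m : ℂ) ^ 2 * f s).aestronglyMeasurable (by norm_num) (μ := volume))
  refine h1.trans ((add_le_add_right (eLpNorm_const_mul_eq ((m : ℂ) ^ 2) f).le _).trans ?_)
  rw [mul_add]
  refine add_le_add ?_ (le_of_eq ?_)
  · refine le_mul_of_one_le_left zero_le ?_
    rw [← ENNReal.ofReal_one]
    exact ENNReal.ofReal_le_ofReal (one_le_pow₀ hm1)
  · simp

lemma eLpNorm_modeLap_add_le {ρ ω : ℝ → ℂ} (hρ : ContDiff ℝ (⊤ : ℕ∞) ρ)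
    (hω : ContDiff ℝ (⊤ : ℕ∞) ω) {m : ℕ} (hm : 1 ≤ m) :
    eLpNorm (modeLap m ρ) 2 volume + eLpNorm (modeLap m ω) 2 volume
      ≤ ENNReal.ofReal ((m : ℝ) ^ 2) * Qsum 4 ρ ω := by
  refine (add_le_add (eLpNorm_modeLap_le hρ hm) (eLpNorm_modeLap_le hω hm)).trans ?_
  rw [← mul_add]
  refine mul_le_mul_right ?_ _
  simp only [Qsum, Finset.sum_range_succ, Finset.sum_range_zero, iteratedDeriv_succ,
    iteratedDeriv_zero, zero_add]
  calc _ ≤ (eLpNorm (deriv (deriv ρ)) 2 volume + eLpNorm ρ 2 volume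
        + (eLpNorm (deriv (deriv ω)) 2 volume + eLpNorm ω 2 volume))
        + (eLpNorm (deriv ρ) 2 volume + eLpNorm (deriv ω) 2 volume
          + (eLpNorm (deriv (deriv (deriv ρ))) 2 volume
            + eLpNorm (deriv (deriv (deriv ω))) 2 volume)) := le_self_add
    _ = _ := by ring

lemma eLpNorm_modeLap_deriv_add_le {ρ ω : ℝ → ℂ} (hρ : ContDiff ℝ (⊤ : ℕ∞) ρ)
    (hω : ContDiff ℝ (⊤ : ℕ∞) ω) {m : ℕ} (hm : 1 ≤ m) :
    eLpNorm (modeLap m (deriv ρ)) 2 volume + eLpNorm (modeLap m (deriv ω)) 2 volume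
      ≤ ENNReal.ofReal ((m : ℝ) ^ 2) * Qsum 4 ρ ω := by
  refine (add_le_add (eLpNorm_modeLap_le hρ.deriv_infty hm)
    (eLpNorm_modeLap_le hω.deriv_infty hm)).trans ?_
  rw [← mul_add]
  refine mul_le_mul_right ?_ _
  simp only [Qsum, Finset.sum_range_succ, Finset.sum_range_zero, iteratedDeriv_succ,
    iteratedDeriv_zero, zero_add]
  calc _ ≤ (eLpNorm (deriv (deriv (deriv ρ))) 2 volume + eLpNorm (deriv ρ) 2 volume
        + (eLpNorm (deriv (deriv (deriv ω))) 2 volume + eLpNorm (deriv ω) 2 volume))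
        + (eLpNorm ρ 2 volume + eLpNorm ω 2 volume
          + (eLpNorm (deriv (deriv ρ)) 2 volume
            + eLpNorm (deriv (deriv ω)) 2 volume)) := le_self_add
    _ = _ := by ring

/-- The inner `ξ`-integral of the stream function as a function of `y ∓ η`. -/
def innerConv (β : ℝ) (m : ℕ) (w : ℝ → ℂ) (ε : ℝ) (f g : ℝ → ℂ) (s : ℝ) : ℂ :=
  halfConv (Ioi 0) (fun ξ => w (m * ξ)) ε f s
    + -(ε * (1 / (β : ℂ) ^ 2)) * halfConv (Ioi 0) (fun ξ => ξ * w (m * ξ)) ε g s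

section Mode

variable {κ D : ℝ} {w w1 w2 : ℝ → ℂ}

lemma DecayProfile.integrableOn_scaled (P : DecayProfile κ D w w1 w2) {m : ℕ} (hm : 1 ≤ m) :
    IntegrableOn (fun ξ : ℝ => w (m * ξ)) (Ioi 0) :=
  integrableOn_Ioi_comp_const_mul (by positivity) (by simpa using P.integrableOn)

lemma DecayProfile.integrableOn_mul_scaled (P : DecayProfile κ D w w1 w2) {m : ℕ} (hm : 1 ≤ m) :
    IntegrableOn (fun ξ : ℝ => (ξ : ℂ) * w (m * ξ)) (Ioi 0) := by
  have hm0 : (m : ℂ) ≠ 0 := by exact_mod_cast (by omega : m ≠ 0)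
  have h := (integrableOn_Ioi_comp_const_mul (f := fun x : ℝ => (x : ℂ) * w x) (M := m) (a := 0)
    (by positivity) (by simpa using P.integrableOn_mul)).const_mul ((m : ℂ)⁻¹)
  refine h.congr (ae_of_all _ fun ξ => ?_)
  simp only
  push_cast
  field_simp

lemma integral_norm_comp_natCast_mul (w : ℝ → ℂ) {m : ℕ} (hm : 1 ≤ m) :
    ∫ ξ in Ioi (0 : ℝ), ‖w (m * ξ)‖ = (m : ℝ)⁻¹ * ∫ x in Ioi 0, ‖w x‖ := by
  rw [integral_Ioi_norm_comp_const_mul _ (by positivity), mul_zero]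

lemma integral_norm_mul_comp_natCast_mul (w : ℝ → ℂ) {m : ℕ} (hm : 1 ≤ m) :
    ∫ ξ in Ioi (0 : ℝ), ‖(ξ : ℂ) * w (m * ξ)‖
      = (m : ℝ)⁻¹ * ((m : ℝ)⁻¹ * ∫ x in Ioi (0 : ℝ), ‖(x : ℂ) * w x‖) := by
  have h := integral_Ioi_norm_comp_const_mul (fun x : ℝ => (x : ℂ) * w x) (M := m)
    (by positivity) 0
  rw [mul_zero] at h
  rw [← h, ← integral_const_mul]
  congr 1
  ext ξ
  have hm0 : (m : ℝ) ≠ 0 := by positivity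
  rw [norm_mul, norm_mul, Complex.ofReal_mul, norm_mul, Complex.ofReal_natCast,
    Complex.norm_natCast]
  field_simp

lemma BddC1.innerConv (P : DecayProfile κ D w w1 w2) (β : ℝ) {m : ℕ} (hm : 1 ≤ m) (ε : ℝ)
    {f f' g g' : ℝ → ℂ} (hf : BddC1 f f') (hg : BddC1 g g') :
    BddC1 (innerConv β m w ε f g) (innerConv β m w ε f' g') :=
  (BddC1.halfConv (P.integrableOn_scaled hm) hf ε).add
    ((BddC1.halfConv (P.integrableOn_mul_scaled hm) hg ε).const_mul _)

lemma eLpNorm_innerConv_le (P : DecayProfile κ D w w1 w2) (β : ℝ) {m : ℕ} (hm : 1 ≤ m) {ε : ℝ}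
    (hε : ε * ε = 1) {f g : ℝ → ℂ} (hf : Continuous f) (hf' : ∃ M, ∀ s, ‖f s‖ ≤ M)
    (hg : Continuous g) (hg' : ∃ M, ∀ s, ‖g s‖ ≤ M) {Q : ℝ≥0∞}
    (hQ : eLpNorm f 2 volume + eLpNorm g 2 volume ≤ ENNReal.ofReal ((m : ℝ) ^ 2) * Q) :
    eLpNorm (innerConv β m w ε f g) 2 volume
      ≤ ENNReal.ofReal (m * ((∫ x in Ioi 0, ‖w x‖)
        + 1 / β ^ 2 * ∫ x in Ioi (0 : ℝ), ‖(x : ℂ) * w x‖)) * Q := by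
  have hm1 : (1 : ℝ) ≤ m := by exact_mod_cast hm
  have hm0 : (m : ℝ) ≠ 0 := by positivity
  have hε1 : |ε| = 1 := by
    rcases mul_self_eq_one_iff.1 hε with h | h <;> simp [h]
  have hk := P.integrableOn_scaled hm
  have hk' := P.integrableOn_mul_scaled hm
  have c1 := continuous_halfConv hk hf hf' ε
  have c2 := continuous_halfConv hk' hg hg' ε
  set A := ∫ x in Ioi 0, ‖w x‖
  set A1 := ∫ x in Ioi (0 : ℝ), ‖(x : ℂ) * w x‖
  have hA : 0 ≤ A := integral_nonneg fun _ => norm_nonneg _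
  have hA1 : 0 ≤ A1 := integral_nonneg fun _ => norm_nonneg _
  have hA2 : 0 ≤ 1 / β ^ 2 * A1 := by positivity
  have hc : ‖-((ε : ℂ) * (1 / (β : ℂ) ^ 2))‖ = 1 / β ^ 2 := by
    rw [norm_neg, norm_mul, Complex.norm_real, Real.norm_eq_abs, hε1, one_mul, norm_div, norm_one,
      norm_pow, Complex.norm_real, Real.norm_eq_abs, sq_abs]
  have e1 : (m : ℝ)⁻¹ * A ≤ (m : ℝ)⁻¹ * (A + 1 / β ^ 2 * A1) := by
    gcongr
    linarith
  have e2 : 1 / β ^ 2 * ((m : ℝ)⁻¹ * ((m : ℝ)⁻¹ * A1)) ≤ (m : ℝ)⁻¹ * (A + 1 / β ^ 2 * A1) := by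
    have : (m : ℝ)⁻¹ * (1 / β ^ 2 * A1) ≤ 1 / β ^ 2 * A1 :=
      mul_le_of_le_one_left hA2 (inv_le_one_of_one_le₀ hm1)
    calc _ = (m : ℝ)⁻¹ * ((m : ℝ)⁻¹ * (1 / β ^ 2 * A1)) := by ring
      _ ≤ _ := by
        gcongr
        linarith
  calc eLpNorm (innerConv β m w ε f g) 2 volume
      ≤ ENNReal.ofReal ((m : ℝ)⁻¹ * A) * eLpNorm f 2 volume
        + ENNReal.ofReal (1 / β ^ 2) * (ENNReal.ofReal ((m : ℝ)⁻¹ * ((m : ℝ)⁻¹ * A1))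
          * eLpNorm g 2 volume) := by
        refine (eLpNorm_add_le c1.aestronglyMeasurable
          (continuous_const.mul c2).aestronglyMeasurable (by norm_num)).trans (add_le_add ?_ ?_)
        · rw [← integral_norm_comp_natCast_mul w hm]
          exact eLpNorm_halfConv_le hk hf ε
        · refine (eLpNorm_const_mul_eq _ _).trans_le ?_
          rw [hc, ← integral_norm_mul_comp_natCast_mul w hm]
          exact mul_le_mul_right (eLpNorm_halfConv_le hk' hg ε) _
    _ ≤ ENNReal.ofReal ((m : ℝ)⁻¹ * (A + 1 / β ^ 2 * A1)) * eLpNorm f 2 volume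
        + ENNReal.ofReal ((m : ℝ)⁻¹ * (A + 1 / β ^ 2 * A1)) * eLpNorm g 2 volume := by
        rw [← mul_assoc, ← ENNReal.ofReal_mul (by positivity)]
        exact add_le_add (mul_le_mul_left (ENNReal.ofReal_le_ofReal e1) _)
          (mul_le_mul_left (ENNReal.ofReal_le_ofReal e2) _)
    _ = ENNReal.ofReal ((m : ℝ)⁻¹ * (A + 1 / β ^ 2 * A1))
        * (eLpNorm f 2 volume + eLpNorm g 2 volume) := by ring
    _ ≤ ENNReal.ofReal ((m : ℝ)⁻¹ * (A + 1 / β ^ 2 * A1)) * (ENNReal.ofReal ((m : ℝ) ^ 2) * Q) :=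
        mul_le_mul_right hQ _
    _ = _ := by
        rw [← mul_assoc, ← ENNReal.ofReal_mul (by positivity)]
        congr 2
        field_simp

/-- The phase-carrying function `e^{-imts} Φ_ε(s)`. -/
def phaseInner (β : ℝ) (m : ℕ) (w : ℝ → ℂ) (ε t : ℝ) (ρ ω : ℝ → ℂ) (s : ℝ) : ℂ :=
  Complex.exp (-(Complex.I * ((m * t : ℝ) : ℂ) * s))
    * innerConv β m w ε (modeLap m ρ) (modeLap m ω) s

lemma integral_mul_Gm_eq {β : ℝ} (P : DecayProfile κ D w w1 w2) {m : ℕ} (hm : 1 ≤ m)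
    {ρ ω : ℝ → ℂ} (hρ : ContDiff ℝ (⊤ : ℕ∞) ρ) (sρ : HasCompactSupport ρ)
    (hω : ContDiff ℝ (⊤ : ℕ∞) ω) (sω : HasCompactSupport ω) (ε η y : ℝ) :
    ∫ ξ in Ioi (0 : ℝ), w (m * ξ) * Gm β m ρ ω (ε * η) (ε * ξ) y
      = innerConv β m w ε (modeLap m ρ) (modeLap m ω) (y + -ε * η) := by
  have bρ := hρ.bddC1_modeLap sρ m
  have bω := hω.bddC1_modeLap sω m
  rw [innerConv, halfConv, halfConv, ← integral_const_mul, ← integral_add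
    (integrableOn_mul_comp_add (P.integrableOn_scaled hm) bρ.continuous bρ.bounded _ _)
    ((integrableOn_mul_comp_add (P.integrableOn_mul_scaled hm)
      bω.continuous bω.bounded _ _).const_mul _)]
  congr 1
  ext ξ
  rw [Gm, show ε * ξ + y - ε * η = y + -ε * η + ε * ξ by ring, modeLap, modeLap]
  push_cast
  ring

lemma psiM_eq {β : ℝ} {κ D : ℝ} {w1 w2 : ℝ → ℂ}
    (P : DecayProfile κ D (fun x : ℝ => whittW (gam β) (2 * (x : ℂ))) w1 w2)
    {m : ℕ} (hm : 1 ≤ m) {ρ ω : ℝ → ℂ} (hρ : ContDiff ℝ (⊤ : ℕ∞) ρ) (sρ : HasCompactSupport ρ)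
    (hω : ContDiff ℝ (⊤ : ℕ∞) ω) (sω : HasCompactSupport ω) (t y : ℝ) :
    psiM β m ρ ω t y = Complex.cos (gam β * (π : ℂ)) / (2 * m * (π : ℂ)) *
      (halfConv (Ioi 0) (fun η => whittW (gam β) (2 * ((m * η : ℝ) : ℂ))) (-1)
          (phaseInner β m (fun x : ℝ => whittW (gam β) (2 * (x : ℂ))) 1 t ρ ω) y
        - halfConv (Ioi 0) (fun η => whittW (gam β) (2 * ((m * η : ℝ) : ℂ))) 1
          (phaseInner β m (fun x : ℝ => whittW (gam β) (2 * (x : ℂ))) (-1) t ρ ω) y) := by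
  have hW : ∀ x : ℝ, whittW (gam β) (2 * (m : ℂ) * (x : ℂ))
      = whittW (gam β) (2 * ((m * x : ℝ) : ℂ)) := fun x => by push_cast; rw [mul_assoc]
  have hG1 := fun η => integral_mul_Gm_eq (β := β) P hm hρ sρ hω sω 1 η y
  have hG2 := fun η => integral_mul_Gm_eq (β := β) P hm hρ sρ hω sω (-1) η y
  simp only [one_mul, neg_mul, neg_neg] at hG1 hG2
  simp only [psiM, hW, hG1, hG2, halfConv, phaseInner]
  rw [mul_div_assoc, mul_comm (Complex.exp _) (_ / _), mul_assoc, mul_sub (Complex.exp _),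
    ← integral_const_mul, ← integral_const_mul]
  congr 3
  · ext η
    rw [show -(Complex.I * ((m * t : ℝ) : ℂ) * ((y + -1 * η : ℝ) : ℂ))
      = -(Complex.I * m * y * t) + Complex.I * m * η * t by push_cast; ring, Complex.exp_add,
      neg_one_mul]
    ring
  · ext η
    rw [show -(Complex.I * ((m * t : ℝ) : ℂ) * ((y + 1 * η : ℝ) : ℂ))
      = -(Complex.I * m * y * t) + -(Complex.I * m * η * t) by push_cast; ring, Complex.exp_add,
      one_mul]
    ring

end Mode

lemma halfConv_deriv_eq_of_decayProfile {κ D : ℝ} {w w1 w2 : ℝ → ℂ} (P : DecayProfile κ D w w1 w2)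
    {m : ℕ} (hm : 1 ≤ m) {ε : ℝ} (hε : ε * ε = 1) {h h' : ℝ → ℂ} (hh : BddC1 h h') (y : ℝ) :
    halfConv (Ioi 0) (fun η => w (m * η)) ε h' y
      = -(ε * halfConv (Ioi 0) (fun η => ((m : ℝ) : ℂ) * w1 (m * η)) ε h y) := by
  have hm0 : (0 : ℝ) < m := by positivity
  have hlim : Tendsto (fun η : ℝ => w (m * η)) (𝓝[>] 0) (𝓝 0) := by
    refine P.tendsto_zero.comp (tendsto_nhdsWithin_iff.2 ⟨?_, ?_⟩)
    · have : Continuous fun η : ℝ => (m : ℝ) * η := by fun_prop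
      simpa using (this.tendsto 0).mono_left nhdsWithin_le_nhds
    · filter_upwards [self_mem_nhdsWithin] with η hη
      exact mul_pos hm0 hη
  have hk1 : IntegrableOn (fun η => ((m : ℝ) : ℂ) * w1 (m * η)) (Ioi 0) :=
    (integrableOn_Ioi_comp_const_mul hm0 (by simpa using P.integrableOn_deriv)).const_mul _
  rw [halfConv_deriv_eq hε (P.integrableOn_scaled hm) hk1
    (fun η hη => HasDerivAt.comp_const_mul_ofReal hm0 P.hasDerivAt hη) hlim
    (tendsto_atTop_comp_const_mul hm0 P.tendsto_atTop) hh y]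
  simp

/-- Decay of a single Fourier mode, with a constant independent of the mode. -/
lemma eLpNorm_deriv_psiM_le {β κ D : ℝ} {w1 w2 : ℝ → ℂ} (hκ : κ ≤ 1)
    (P : DecayProfile κ D (fun x : ℝ => whittW (gam β) (2 * (x : ℂ))) w1 w2) :
    ∃ C : ℝ, 0 ≤ C ∧ ∀ (m : ℕ) (ρ ω : ℝ → ℂ), 1 ≤ m → ContDiff ℝ (⊤ : ℕ∞) ρ →
      HasCompactSupport ρ → ContDiff ℝ (⊤ : ℕ∞) ω → HasCompactSupport ω → ∀ t : ℝ, 1 ≤ t →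
      eLpNorm (fun y => deriv (fun y' => psiM β m ρ ω t y') y) 2 volume
        ≤ ENNReal.ofReal (C * t ^ (-κ)) * Qsum 4 ρ ω := by
  set w : ℝ → ℂ := fun x => whittW (gam β) (2 * (x : ℂ))
  set B : ℝ := (∫ x in Ioi 0, ‖w x‖) + 1 / β ^ 2 * ∫ x in Ioi (0 : ℝ), ‖(x : ℂ) * w x‖
  set E : ℝ := 3 * D + ∫ x in Ioi 0, ‖w1 x‖
  set c : ℝ := ‖Complex.cos (gam β * (π : ℂ))‖
  have hB : 0 ≤ B := add_nonneg (integral_nonneg fun _ => norm_nonneg _)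
    (mul_nonneg (by positivity) (integral_nonneg fun _ => norm_nonneg _))
  have hD : 0 ≤ D := by
    have := (norm_nonneg _).trans (P.norm_deriv_le 1 one_pos)
    simpa using this
  have hE : 0 ≤ E := add_nonneg (by positivity) (integral_nonneg fun _ => norm_nonneg _)
  refine ⟨c / π * E * B, by positivity, fun m ρ ω hm hρ sρ hω sω t ht => ?_⟩
  have hm1 : (1 : ℝ) ≤ m := by exact_mod_cast hm
  have hm0 : (0 : ℝ) < m := by positivity
  have bρ := hρ.bddC1_modeLap sρ m
  have bω := hω.bddC1_modeLap sω m
  have hin : ∀ ε, BddC1 (innerConv β m w ε (modeLap m ρ) (modeLap m ω))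
      (innerConv β m w ε (modeLap m (deriv ρ)) (modeLap m (deriv ω))) := fun ε =>
    BddC1.innerConv P β hm ε bρ bω
  set N : ℝ → ℝ → ℂ := fun ε =>
    halfConv (Ioi 0) (fun η => ((m : ℝ) : ℂ) * w1 (m * η)) (-ε) (phaseInner β m w ε t ρ ω)
  have hN : ∀ ε, ε * ε = 1 → eLpNorm (N ε) 2 volume
      ≤ ENNReal.ofReal (E * t ^ (-κ)) * (ENNReal.ofReal (m * B) * Qsum 4 ρ ω) := fun ε hε =>
    P.eLpNorm_halfConv_le hκ hm0 ht hm1 (by simpa using hε) (hin ε)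
      (eLpNorm_innerConv_le P β hm hε bρ.continuous bρ.bounded bω.continuous bω.bounded
        (eLpNorm_modeLap_add_le hρ hω hm))
      (eLpNorm_innerConv_le P β hm hε bρ.continuous_deriv bρ.bounded_deriv
        bω.continuous_deriv bω.bounded_deriv (eLpNorm_modeLap_deriv_add_le hρ hω hm))
  have hk1 : IntegrableOn (fun η => ((m : ℝ) : ℂ) * w1 (m * η)) (Ioi 0) :=
    (integrableOn_Ioi_comp_const_mul hm0 (by simpa using P.integrableOn_deriv)).const_mul _
  have hNc : ∀ ε, Continuous (N ε) := fun ε =>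
    continuous_halfConv hk1 ((hin ε).exp_mul _).continuous ((hin ε).exp_mul _).bounded _
  have hd : ∀ ε y, ε * ε = 1 → HasDerivAt
      (halfConv (Ioi 0) (fun η => w (m * η)) (-ε) (phaseInner β m w ε t ρ ω)) (ε * N ε y) y := by
    intro ε y hε
    have hph := (hin ε).exp_mul (m * t)
    refine ((BddC1.halfConv (P.integrableOn_scaled hm) hph (-ε)).hasDerivAt y).congr_deriv ?_
    rw [halfConv_deriv_eq_of_decayProfile P hm (by simpa using hε) hph]
    rw [Complex.ofReal_neg, neg_mul, neg_neg]
    rfl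
  set a : ℂ := Complex.cos (gam β * (π : ℂ)) / (2 * m * (π : ℂ))
  have ha : ‖a‖ = c / (2 * m * π) := by
    simp only [a, c, norm_div, norm_mul, Complex.norm_natCast, Complex.norm_real,
      Real.norm_of_nonneg Real.pi_pos.le]
    norm_num
  have hder : (fun y => deriv (fun y' => psiM β m ρ ω t y') y)
      = fun y => a * ((N 1 + N (-1)) y) := by
    ext y
    have h1 := hd 1 y (by norm_num)
    have h2 := hd (-1) y (by norm_num)
    rw [neg_neg] at h2
    have h3 := (h1.sub h2).const_mul a
    have hfun : (fun y' => psiM β m ρ ω t y') = fun y' => a *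
        (halfConv (Ioi 0) (fun η => w (m * η)) (-1) (phaseInner β m w 1 t ρ ω) y'
          - halfConv (Ioi 0) (fun η => w (m * η)) 1 (phaseInner β m w (-1) t ρ ω) y') :=
      funext fun y' => psiM_eq P hm hρ sρ hω sω t y'
    rw [hfun]
    refine h3.deriv.trans ?_
    simp
  rw [hder, eLpNorm_const_mul_eq, ha]
  calc _ ≤ ENNReal.ofReal (c / (2 * m * π)) *
        (ENNReal.ofReal (E * t ^ (-κ)) * (ENNReal.ofReal (m * B) * Qsum 4 ρ ω)
          + ENNReal.ofReal (E * t ^ (-κ)) * (ENNReal.ofReal (m * B) * Qsum 4 ρ ω)) := by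
        refine mul_le_mul_right ((eLpNorm_add_le (hNc 1).aestronglyMeasurable
          (hNc (-1)).aestronglyMeasurable (by norm_num)).trans ?_) _
        exact add_le_add (hN 1 (by norm_num)) (hN (-1) (by norm_num))
    _ = ENNReal.ofReal (c / (2 * m * π) * (2 * (E * t ^ (-κ) * (m * B)))) * Qsum 4 ρ ω := by
        have ht' : 0 ≤ t ^ (-κ) := by positivity
        rw [ENNReal.ofReal_mul (by positivity : 0 ≤ c / (2 * m * π)),
          ENNReal.ofReal_mul (by positivity : (0 : ℝ) ≤ 2),
          ENNReal.ofReal_mul (by positivity : 0 ≤ E * t ^ (-κ)), ENNReal.ofReal_ofNat]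
        ring
    _ = _ := by
        congr 2
        field_simp

lemma tsum_sq_rpow_half_le {f g : ℕ → ℝ≥0∞} {c : ℝ≥0∞} (h : ∀ n, f n ≤ c * g n) :
    (∑' n, f n ^ 2) ^ ((1 : ℝ) / 2) ≤ c * (∑' n, g n ^ 2) ^ ((1 : ℝ) / 2) := by
  have hc : (c ^ 2) ^ ((1 : ℝ) / 2) = c := by
    rw [← ENNReal.rpow_natCast, ← ENNReal.rpow_mul]
    norm_num
  calc (∑' n, f n ^ 2) ^ ((1 : ℝ) / 2) ≤ (∑' n, c ^ 2 * g n ^ 2) ^ ((1 : ℝ) / 2) := by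
        refine ENNReal.rpow_le_rpow (ENNReal.tsum_le_tsum fun n => ?_) (by norm_num)
        rw [← mul_pow]
        exact pow_le_pow_left₀ zero_le (h n) 2
    _ = _ := by rw [ENNReal.tsum_mul_left, ENNReal.mul_rpow_of_nonneg _ _ (by norm_num), hc]

lemma exists_decayProfile_whittW {β : ℝ} (hβ : 0 < β) (hβ4 : β ^ 2 ≠ 1 / 4) :
    ∃ (D : ℝ) (w1 w2 : ℝ → ℂ), DecayProfile (1 / 2 - (gam β).re) D
      (fun x : ℝ => whittW (gam β) (2 * (x : ℂ))) w1 w2 := by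
  obtain ⟨hsq, hne, hre0, hre⟩ := gam_properties hβ hβ4
  obtain ⟨w1, w2, K, hK, hw, hw1, hw2, b, b1, b2⟩ :=
    whittW_bounds (b := β ^ 2) (by positivity) hsq hne hre0 hre
  obtain ⟨D, -, hD⟩ := exists_decayProfile (by linarith) (by linarith) hK hw hw1 hw2 b b1 b2
  exact ⟨D, w1, w2, hD⟩

end

/-- Fourier-side form of estimate (1.12) of Theorem 1.2, case `β² ≠ 1/4`:
the horizontal velocity `u^x = −∂_yψ` decays in `L²(𝕋×ℝ)` at rate `t^{−1/2+μ}`: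
`(∑_{m≥1} ‖∂_yψ_m(t)‖²_{L²})^{1/2} ≤ C t^{−1/2+μ} (∑_{m≥1} Q_{1,m}²)^{1/2}`. -/
theorem ux_decay_summed (β : ℝ) (hβ : 0 < β) (hβ4 : β ^ 2 ≠ 1 / 4) :
    ∃ C : ℝ, 0 < C ∧
      ∀ (ρ₀ ω₀ : ℕ → ℝ → ℂ),
        (∀ m : ℕ, 1 ≤ m → ContDiff ℝ (⊤ : ℕ∞) (ρ₀ m) ∧ HasCompactSupport (ρ₀ m)
          ∧ ContDiff ℝ (⊤ : ℕ∞) (ω₀ m) ∧ HasCompactSupport (ω₀ m)) →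
      ∀ t : ℝ, 1 ≤ t →
        (∑' m : ℕ,
            (eLpNorm (fun y => deriv (fun y' => psiM β (m + 1) (ρ₀ (m + 1)) (ω₀ (m + 1)) t y') y)
              2 (volume : Measure ℝ)) ^ 2) ^ ((1 : ℝ) / 2) ≤
          ENNReal.ofReal (C * t ^ (-(1 : ℝ) / 2 + (gam β).re)) *
            (∑' m : ℕ, (Qsum 4 (ρ₀ (m + 1)) (ω₀ (m + 1))) ^ 2) ^ ((1 : ℝ) / 2) := by
  obtain ⟨D, w1, w2, P⟩ := exists_decayProfile_whittW hβ hβ4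
  obtain ⟨-, -, hre0, -⟩ := gam_properties hβ hβ4
  obtain ⟨C, hC, h⟩ := eLpNorm_deriv_psiM_le (by linarith) P
  refine ⟨C + 1, by positivity, fun ρ₀ ω₀ hdata t ht => tsum_sq_rpow_half_le fun n => ?_⟩
  obtain ⟨h1, h2, h3, h4⟩ := hdata (n + 1) (by omega)
  refine (h (n + 1) _ _ (by omega) h1 h2 h3 h4 t ht).trans
    (mul_le_mul_left (ENNReal.ofReal_le_ofReal ?_) _)
  rw [show -(1 / 2 - (gam β).re) = -(1 : ℝ) / 2 + (gam β).re by ring]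
  exact mul_le_mul_of_nonneg_right (by linarith) (by positivity)
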